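/- Let (R, m) be a Noetherian local ring and M a finitely generated R-module with canonical module ω_M. Then Supp_R(ω_M) = { p ∈ Supp_R(M) : ht_M(p) + dim(R/p) = dim M }, where ht_M(p) = dim_{R_p}(M_p). -/

import Mathlib

open CategoryTheory IsLocalRing Pointwise

noncomputable section

/-- `E` is an injective hull of `S ⧸ J` over `S`. -/
def IsInjHull (S : Type) [CommRing S] (J : Ideal S) (E : Type) [AddCommGroup E]
    [Module S E] : Prop :=
  Module.Injective S E ∧
    ∃ f : (S ⧸ J) →ₗ[S] E, Function.Injective f ∧
      ∀ N : Submodule S E, N ≠ ⊥ → N ⊓ LinearMap.range f ≠ ⊥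

/-- Local cohomology `H^i_J(M)`. -/
abbrev LC (S : Type) [CommRing S] (J : Ideal S) (i : ℕ) (M : ModuleCat S) : ModuleCat S :=
  (localCohomology J i).obj M

/-- Krull dimension of a module (dimension of its support). -/
def mdim (S : Type) [CommRing S] (M : Type) [AddCommGroup M] [Module S M] : WithBot ℕ∞ :=
  Order.krullDim (Module.support S M)

/-- Depth/grade of an ideal `J` on `M`: supremum of lengths of `M`-regular sequences in `J`. -/
def gradeI (S : Type) [CommRing S] (J : Ideal S) (M : Type) [AddCommGroup M]
    [Module S M] : ℕ∞ :=
  sSup {n : ℕ∞ | ∃ rs : List S, (rs.length : ℕ∞) = n ∧ (∀ r ∈ rs, r ∈ J) ∧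
    RingTheory.Sequence.IsRegular M rs}

/-- The local "height" of `M` at a prime `p`, i.e. `dim_{S_p} M_p`. -/
def htM (S : Type) [CommRing S] (M : Type) [AddCommGroup M] [Module S M]
    (p : PrimeSpectrum S) : WithBot ℕ∞ :=
  mdim (Localization.AtPrime p.asIdeal) (LocalizedModule p.asIdeal.primeCompl M)

/-- `ht_M(a) = inf { dim_{S_p} M_p : p ⊇ a, p ∈ Supp M }`. -/
def htI (S : Type) [CommRing S] (M : Type) [AddCommGroup M] [Module S M]
    (a : Ideal S) : WithBot ℕ∞ :=
  sInf {d | ∃ p ∈ Module.support S M, a ≤ p.asIdeal ∧ d = htM S M p}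

/-- Serre's condition `S_n` for the module `M`. -/
def Serre (S : Type) [CommRing S] (n : ℕ) (M : Type) [AddCommGroup M] [Module S M] : Prop :=
  ∀ (p : Ideal S) [p.IsPrime],
    min (n : WithBot ℕ∞)
        (mdim (Localization.AtPrime p) (LocalizedModule p.primeCompl M)) ≤
      (gradeI (Localization.AtPrime p) (IsLocalRing.maximalIdeal (Localization.AtPrime p))
        (LocalizedModule p.primeCompl M) : ℕ∞)

/-- Attached primes of `M` (Macdonald): primes of the form `Ann(M ⧸ N)`. -/
def attachedPrimes (S : Type) [CommRing S] (M : Type) [AddCommGroup M] [Module S M] :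
    Set (Ideal S) :=
  {p | p.IsPrime ∧ ∃ N : Submodule S M, p = Module.annihilator S (M ⧸ N)}

/-- `ω` is a canonical module of the `d`-dimensional module `M` over `(S, J)`:
its "Matlis dual" `Hom_S(ω, E)` is isomorphic to `H^d_J(M)`. -/
def IsCanonicalModule (S : Type) [CommRing S] (J : Ideal S) (d : ℕ)
    (M ω : ModuleCat S) : Prop :=
  Module.Finite S ω ∧ ∃ E : ModuleCat S, IsInjHull S J ↥E ∧
    Nonempty ((↥ω →ₗ[S] ↥E) ≃ₗ[S] ↥(LC S J d M))

/-- `(S, J)` is quasi-Gorenstein: `H^d_J(S)` is an injective hull of `S ⧸ J`, `d = dim S`. -/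
def IsQuasiGorensteinAt (S : Type) [CommRing S] (J : Ideal S) : Prop :=
  ∃ d : ℕ, ringKrullDim S = (d : WithBot ℕ∞) ∧
    ∃ E : ModuleCat S, IsInjHull S J ↥E ∧
      Nonempty (↥(LC S J d (ModuleCat.of S S)) ≃ₗ[S] ↥E)

/-- Totally reflexive modules. -/
def TotallyReflexive (S : Type) [CommRing S] (M : ModuleCat S) : Prop :=
  Module.Finite S ↥M ∧ Module.IsReflexive S ↥M ∧
    ∀ i : ℕ, 0 < i →
      Subsingleton ↥(((Ext S (ModuleCat S) i).obj (Opposite.op M)).obj (ModuleCat.of S S)) ∧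
      Subsingleton ↥(((Ext S (ModuleCat S) i).obj
        (Opposite.op (ModuleCat.of S (Module.Dual S ↥M)))).obj (ModuleCat.of S S))

/-- `G`-dimension at most `n`. -/
def GdimLE (S : Type) [CommRing S] : ℕ → ModuleCat S → Prop
  | 0, M => TotallyReflexive S M
  | n + 1, M => ∃ (G : ModuleCat S) (f : ↥G →ₗ[S] ↥M), Function.Surjective f ∧
      TotallyReflexive S G ∧ GdimLE S n (ModuleCat.of S (LinearMap.ker f))

/-- Injective dimension at most `n`. -/
def InjDimLE (S : Type) [CommRing S] : ℕ → ModuleCat S → Prop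
  | 0, M => Module.Injective S ↥M
  | n + 1, M => ∃ (E : ModuleCat S) (f : ↥M →ₗ[S] ↥E), Function.Injective f ∧
      Module.Injective S ↥E ∧ InjDimLE S n (ModuleCat.of S (↥E ⧸ LinearMap.range f))

/-- Injective dimension, as an element of `ℕ∞`. -/
def injDim (S : Type) [CommRing S] (M : ModuleCat S) : ℕ∞ :=
  sInf {n : ℕ∞ | ∃ k : ℕ, (k : ℕ∞) = n ∧ InjDimLE S k M}

/-- Minimal number of generators. -/
def genNumber (S : Type) [CommRing S] (M : Type) [AddCommGroup M] [Module S M] : ℕ∞ :=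
  sInf {n : ℕ∞ | ∃ s : Finset M, (s.card : ℕ∞) = n ∧ Submodule.span S (↑s : Set M) = ⊤}

/-- The socle `0 :_M J`. -/
def socle (S : Type) [CommRing S] (J : Ideal S) (M : Type) [AddCommGroup M] [Module S M] :
    Submodule S M :=
  ⨅ r ∈ J, LinearMap.ker (LinearMap.lsmul S M r)

/-- Limit closure of the sequence `x` on `M`. -/
def limClo (S : Type) [CommRing S] {v : ℕ} (x : Fin v → S) (M : Type) [AddCommGroup M]
    [Module S M] : Submodule S M :=
  ⨆ t : ℕ, (Ideal.span (Set.range fun i => x i ^ (t + 1)) • (⊤ : Submodule S M)).comap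
      (LinearMap.lsmul S M ((∏ i, x i) ^ t))

end

/-- Krull dimension of a ring, valued in `WithBot ℕ∞`. -/
noncomputable def rdim (S : Type) [CommRing S] : WithBot ℕ∞ :=
  Order.krullDim (PrimeSpectrum S)

noncomputable section

open Opposite

namespace ExtCocycle
variable {R : Type} [CommRing R]

/-- The functor `Hom(-, Y)` whose left derived functors define `Ext`. -/
abbrev homFunctor (Y : ModuleCat.{0} R) : ModuleCat.{0} R ⥤ (ModuleCat.{0} R)ᵒᵖ :=
  ((linearYoneda R (ModuleCat.{0} R)).obj Y).rightOp

/-- The complex `Hom(P, Y)` in the opposite category. -/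
abbrev homComplex (P : ChainComplex (ModuleCat.{0} R) ℕ) (Y : ModuleCat.{0} R) :
    ChainComplex (ModuleCat.{0} R)ᵒᵖ ℕ :=
  ((homFunctor Y).mapHomologicalComplex _).obj P

/-- The `i`-cocycles of `Hom(P, Y)`. -/
def cocycles (P : ChainComplex (ModuleCat.{0} R) ℕ) (i : ℕ) (Y : ModuleCat.{0} R) :
    Submodule R (P.X i ⟶ Y) :=
  LinearMap.ker (Linear.leftComp R Y (P.d (i + 1) i))

lemma mem_cocycles {P : ChainComplex (ModuleCat.{0} R) ℕ} {i : ℕ} {Y : ModuleCat.{0} R}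
    {φ : P.X i ⟶ Y} : φ ∈ cocycles P i Y ↔ P.d (i + 1) i ≫ φ = 0 := Iff.rfl

def cocyclesι (P : ChainComplex (ModuleCat.{0} R) ℕ) (i : ℕ) (Y : ModuleCat.{0} R) :
    (homComplex P Y).X i ⟶ op (ModuleCat.of R (cocycles P i Y)) :=
  Quiver.Hom.op (ModuleCat.ofHom (cocycles P i Y).subtype)

lemma d_cocyclesι (P : ChainComplex (ModuleCat.{0} R) ℕ) (i : ℕ) (Y : ModuleCat.{0} R) :
    (homComplex P Y).d (i + 1) i ≫ cocyclesι P i Y = 0 := by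
  apply Quiver.Hom.unop_inj
  ext φ
  exact φ.2

def toCocycles (P : ChainComplex (ModuleCat.{0} R) ℕ) (i : ℕ) (Y : ModuleCat.{0} R) :
    (homComplex P Y).opcycles i ⟶ op (ModuleCat.of R (cocycles P i Y)) :=
  (homComplex P Y).descOpcycles (cocyclesι P i Y) (i + 1) (by simp) (d_cocyclesι P i Y)

lemma p_toCocycles (P : ChainComplex (ModuleCat.{0} R) ℕ) (i : ℕ) (Y : ModuleCat.{0} R) :
    (homComplex P Y).pOpcycles i ≫ toCocycles P i Y = cocyclesι P i Y :=
  HomologicalComplex.p_descOpcycles _ _ _ _ _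

instance (P : ChainComplex (ModuleCat.{0} R) ℕ) (i : ℕ) (Y : ModuleCat.{0} R) :
    IsIso (toCocycles P i Y) := by
  have hex : (ShortComplex.mk _ _ (d_cocyclesι P i Y)).Exact := by
    rw [← ShortComplex.exact_unop_iff, ShortComplex.moduleCat_exact_iff]
    intro φ hφ
    exact ⟨⟨φ, hφ⟩, rfl⟩
  have hepi : Epi (cocyclesι P i Y) := by
    have : Mono (ModuleCat.ofHom (cocycles P i Y).subtype) :=
      (ModuleCat.mono_iff_injective _).2 Subtype.val_injective
    exact CategoryTheory.op_epi_of_mono (ModuleCat.ofHom (cocycles P i Y).subtype)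
  obtain ⟨h⟩ := (ShortComplex.exact_and_epi_g_iff_g_is_cokernel _).1 ⟨hex, hepi⟩
  have h' := (homComplex P Y).opcyclesIsCokernel (i + 1) i (by simp)
  let e := h'.coconePointUniqueUpToIso h
  have : toCocycles P i Y = e.hom := by
    rw [← cancel_epi ((homComplex P Y).pOpcycles i), p_toCocycles]
    exact (h'.comp_coconePointUniqueUpToIso_hom h Limits.WalkingParallelPair.one).symm
  rw [this]
  infer_instance

def homologyClass (P : ChainComplex (ModuleCat.{0} R) ℕ) (i : ℕ) (Y : ModuleCat.{0} R) :
    (homComplex P Y).homology i ⟶ op (ModuleCat.of R (cocycles P i Y)) :=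
  (homComplex P Y).homologyι i ≫ toCocycles P i Y

lemma homologyClass_unop_surjective (P : ChainComplex (ModuleCat.{0} R) ℕ) (i : ℕ)
    (Y : ModuleCat.{0} R) : Function.Surjective (homologyClass P i Y).unop := by
  have : Mono (homologyClass P i Y) := by
    unfold homologyClass
    infer_instance
  exact (ModuleCat.epi_iff_surjective _).1 inferInstance

lemma exists_of_homologyClass_unop_eq_zero {P : ChainComplex (ModuleCat.{0} R) ℕ} {i : ℕ}
    {Y : ModuleCat.{0} R} (φ : cocycles P i Y) (h : (homologyClass P i Y).unop φ = 0) (j : ℕ)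
    (hj : (ComplexShape.down ℕ).next i = j) : ∃ ψ : P.X j ⟶ Y, φ.1 = P.d i j ≫ ψ := by
  have hex := ShortComplex.exact_of_f_is_kernel
    (ShortComplex.mk _ _ ((homComplex P Y).homologyι_comp_fromOpcycles i j))
    ((homComplex P Y).homologyIsKernel i j hj)
  rw [← ShortComplex.exact_unop_iff, ShortComplex.moduleCat_exact_iff] at hex
  obtain ⟨ψ, hψ⟩ := hex ((toCocycles P i Y).unop φ) h
  refine ⟨ψ, ?_⟩
  have h1 := congrArg (fun f => f.unop φ) (p_toCocycles P i Y)
  have h2 := congrArg (fun f => f.unop ψ) ((homComplex P Y).p_fromOpcycles i j)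
  have h3 := congrArg ((homComplex P Y).pOpcycles i).unop hψ
  exact h1.symm.trans (h3.symm.trans h2)

lemma homologyClass_unop_eq_zero {P : ChainComplex (ModuleCat.{0} R) ℕ} {i : ℕ}
    {Y : ModuleCat.{0} R} (φ : cocycles P i Y) (j : ℕ) (ψ : P.X j ⟶ Y) (h : φ.1 = P.d i j ≫ ψ) :
    (homologyClass P i Y).unop φ = 0 := by
  have h1 := congrArg (fun f => f.unop ψ) ((homComplex P Y).homologyι_comp_fromOpcycles i j)
  have h2 : ((homComplex P Y).fromOpcycles i j).unop ψ = (toCocycles P i Y).unop φ := by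
    have hm : Function.Injective ((homComplex P Y).pOpcycles i).unop :=
      (ModuleCat.mono_iff_injective _).1 inferInstance
    apply hm
    have h1 := congrArg (fun f => f.unop φ) (p_toCocycles P i Y)
    have h2 := congrArg (fun f => f.unop ψ) ((homComplex P Y).p_fromOpcycles i j)
    exact h2.trans (h.symm.trans h1.symm)
  have h3 := congrArg ((homComplex P Y).homologyι i).unop h2
  exact h3.symm.trans h1

def cocyclesMap {P Q : ChainComplex (ModuleCat.{0} R) ℕ} (α : P ⟶ Q) (i : ℕ)
    {Y Y' : ModuleCat.{0} R} (f : Y ⟶ Y') : cocycles Q i Y →ₗ[R] cocycles P i Y' :=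
  (((Linear.rightComp R (P.X i) f) ∘ₗ (Linear.leftComp R Y (α.f i))) ∘ₗ
    (cocycles Q i Y).subtype).codRestrict _ (fun φ => by
      have := mem_cocycles.1 φ.2
      rw [mem_cocycles]
      simp [← HomologicalComplex.Hom.comm_assoc, reassoc_of% this])

lemma coe_cocyclesMap {P Q : ChainComplex (ModuleCat.{0} R) ℕ} (α : P ⟶ Q) (i : ℕ)
    {Y Y' : ModuleCat.{0} R} (f : Y ⟶ Y') (φ : cocycles Q i Y) :
    (cocyclesMap α i f φ).1 = (α.f i ≫ φ.1) ≫ f := rfl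

/-- `Ext` from a projective resolution, in the opposite category. -/
def extIso {X : ModuleCat.{0} R} (P : ProjectiveResolution X) (i : ℕ) (Y : ModuleCat.{0} R) :
    ((homFunctor Y).leftDerived i).obj X ≅ (homComplex P.complex Y).homology i :=
  P.isoLeftDerivedObj (homFunctor Y) i

/-- The class in `Ext` of a cocycle on a projective resolution. -/
def extClass {X : ModuleCat.{0} R} (P : ProjectiveResolution X) (i : ℕ) (Y : ModuleCat.{0} R) :
    cocycles P.complex i Y →ₗ[R] ((Ext R (ModuleCat.{0} R) i).obj (op X)).obj Y :=
  ((extIso P i Y).hom ≫ homologyClass P.complex i Y).unop.hom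

lemma extClass_surjective {X : ModuleCat.{0} R} (P : ProjectiveResolution X) (i : ℕ)
    (Y : ModuleCat.{0} R) : Function.Surjective (extClass P i Y) := by
  have h : Function.Surjective (extIso P i Y).hom.unop :=
    (ModuleCat.epi_iff_surjective _).1 inferInstance
  exact h.comp (homologyClass_unop_surjective P.complex i Y)

lemma extClass_eq_zero_iff {X : ModuleCat.{0} R} (P : ProjectiveResolution X) {i : ℕ}
    {Y : ModuleCat.{0} R} (φ : cocycles P.complex i Y) (j : ℕ)
    (hj : (ComplexShape.down ℕ).next i = j) :
    extClass P i Y φ = 0 ↔ ∃ ψ : P.complex.X j ⟶ Y, φ.1 = P.complex.d i j ≫ ψ := by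
  have h : Function.Injective (extIso P i Y).hom.unop :=
    (ModuleCat.mono_iff_injective _).1 inferInstance
  have h2 : extClass P i Y φ = (extIso P i Y).hom.unop
    ((homologyClass P.complex i Y).unop φ) := rfl
  constructor
  · intro h0
    refine exists_of_homologyClass_unop_eq_zero φ (h ?_) j hj
    exact (h2.symm.trans h0).trans (map_zero (extIso P i Y).hom.unop.hom).symm
  · rintro ⟨ψ, hψ⟩
    rw [h2, homologyClass_unop_eq_zero φ j ψ hψ]
    exact map_zero (extIso P i Y).hom.unop.hom

lemma homologyClass_naturality_left {P Q : ChainComplex (ModuleCat.{0} R) ℕ} (α : P ⟶ Q) (i : ℕ)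
    (Y : ModuleCat.{0} R) :
    HomologicalComplex.homologyMap (((homFunctor Y).mapHomologicalComplex _).map α) i ≫
      homologyClass Q i Y = homologyClass P i Y ≫ (ModuleCat.ofHom (cocyclesMap α i (𝟙 Y))).op := by
  unfold homologyClass
  rw [HomologicalComplex.homologyι_naturality_assoc, Category.assoc]
  congr 1
  rw [← cancel_epi ((homComplex P Y).pOpcycles i), HomologicalComplex.p_opcyclesMap_assoc,
    p_toCocycles, reassoc_of% (p_toCocycles P i Y)]
  rfl

lemma homologyClass_naturality_right (P : ChainComplex (ModuleCat.{0} R) ℕ) (i : ℕ)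
    {Y Y' : ModuleCat.{0} R} (f : Y ⟶ Y') :
    HomologicalComplex.homologyMap ((NatTrans.mapHomologicalComplex
      (NatTrans.rightOp ((linearYoneda R (ModuleCat.{0} R)).map f)) _).app P) i ≫
      homologyClass P i Y = homologyClass P i Y' ≫ (ModuleCat.ofHom (cocyclesMap (𝟙 P) i f)).op := by
  unfold homologyClass
  rw [HomologicalComplex.homologyι_naturality_assoc, Category.assoc]
  congr 1
  rw [← cancel_epi ((homComplex P Y').pOpcycles i), HomologicalComplex.p_opcyclesMap_assoc,
    p_toCocycles, reassoc_of% (p_toCocycles P i Y')]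
  rfl

lemma ext_map_extClass {X X' : ModuleCat.{0} R} (a : X ⟶ X') (P : ProjectiveResolution X)
    (Q : ProjectiveResolution X') (α : P.complex ⟶ Q.complex)
    (h : α.f 0 ≫ Q.π.f 0 = P.π.f 0 ≫ a) (i : ℕ) (Y : ModuleCat.{0} R)
    (φ : cocycles Q.complex i Y) :
    ((Ext R (ModuleCat.{0} R) i).map a.op).app Y (extClass Q i Y φ) =
      extClass P i Y (cocyclesMap α i (𝟙 Y) φ) := by
  have h1 : ((homFunctor Y).leftDerived i).map a ≫ (extIso Q i Y).hom = (extIso P i Y).hom ≫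
      HomologicalComplex.homologyMap (((homFunctor Y).mapHomologicalComplex _).map α) i :=
    ProjectiveResolution.isoLeftDerivedObj_hom_naturality a P Q α h (homFunctor Y) i
  have h2 : ((homFunctor Y).leftDerived i).map a ≫ (extIso Q i Y).hom ≫
      homologyClass Q.complex i Y = (extIso P i Y).hom ≫ homologyClass P.complex i Y ≫
        (ModuleCat.ofHom (cocyclesMap α i (𝟙 Y))).op := by
    rw [reassoc_of% h1, homologyClass_naturality_left]
  exact congrArg (fun f => f.unop φ) h2

lemma ext_obj_map_extClass {X : ModuleCat.{0} R} (P : ProjectiveResolution X) (i : ℕ)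
    {Y Y' : ModuleCat.{0} R} (f : Y ⟶ Y') (φ : cocycles P.complex i Y) :
    ((Ext R (ModuleCat.{0} R) i).obj (op X)).map f (extClass P i Y φ) =
      extClass P i Y' (cocyclesMap (𝟙 _) i f φ) := by
  have h1 : (NatTrans.leftDerived
      (NatTrans.rightOp ((linearYoneda R (ModuleCat.{0} R)).map f)) i).app X =
      (extIso P i Y').hom ≫ HomologicalComplex.homologyMap ((NatTrans.mapHomologicalComplex
        (NatTrans.rightOp ((linearYoneda R (ModuleCat.{0} R)).map f)) _).app P.complex) i ≫
          (extIso P i Y).inv :=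
    ProjectiveResolution.leftDerived_app_eq
      (NatTrans.rightOp ((linearYoneda R (ModuleCat.{0} R)).map f)) P i
  have h2 : (NatTrans.leftDerived
      (NatTrans.rightOp ((linearYoneda R (ModuleCat.{0} R)).map f)) i).app X ≫
      (extIso P i Y).hom ≫ homologyClass P.complex i Y = (extIso P i Y').hom ≫
        homologyClass P.complex i Y' ≫ (ModuleCat.ofHom (cocyclesMap (𝟙 _) i f)).op := by
    rw [h1, Category.assoc, Category.assoc, Iso.inv_hom_id_assoc, homologyClass_naturality_right]
  exact congrArg (fun f => f.unop φ) h2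

end ExtCocycle

namespace LocalCoh
open ExtCocycle localCohomology
variable {R : Type} [CommRing R] (J : Ideal R)

abbrev quotPow (n : ℕ) : ModuleCat.{0} R := ModuleCat.of R (R ⧸ J ^ n)

/-- The chosen projective resolution of `R ⧸ J ^ n`. -/
def res (n : ℕ) : ProjectiveResolution (quotPow J n) := projectiveResolution (quotPow J n)

def quotPowMap {n m : ℕ} (h : n ≤ m) : quotPow J m ⟶ quotPow J n :=
  (ringModIdeals (idealPowersDiagram J)).map (homOfLE h).op

/-- A lift of the projection `R ⧸ J ^ m → R ⧸ J ^ n` to the chosen resolutions. -/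
def trans {n m : ℕ} (h : n ≤ m) : (res J m).complex ⟶ (res J n).complex :=
  ProjectiveResolution.lift (quotPowMap J h) (res J m) (res J n)

lemma trans_comm {n m : ℕ} (h : n ≤ m) :
    (trans J h).f 0 ≫ (res J n).π.f 0 = (res J m).π.f 0 ≫ quotPowMap J h :=
  ProjectiveResolution.lift_commutes_zero _ _ _

/-- The class in local cohomology of a cocycle on the resolution of `R ⧸ J ^ n`. -/
def cl (n i : ℕ) (M : ModuleCat.{0} R) :
    cocycles (res J n).complex i M →ₗ[R] (localCohomology J i).obj M :=
  ((Limits.colimit.ι (diagram (idealPowersDiagram J) i) (op (op n))).app M).hom ∘ₗ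
    extClass (res J n) i M

def isColimitEval (i : ℕ) (M : ModuleCat.{0} R) :=
  Limits.isColimitOfPreserves ((evaluation (ModuleCat.{0} R) (ModuleCat.{0} R)).obj M)
    (Limits.colimit.isColimit (diagram (idealPowersDiagram J) i))

variable {J}

lemma exists_cl {i : ℕ} {M : ModuleCat.{0} R} (c : (localCohomology J i).obj M) :
    ∃ n, ∃ φ, cl J n i M φ = c := by
  obtain ⟨j, y, hy⟩ := Limits.Concrete.isColimit_exists_rep _ (isColimitEval J i M) c
  obtain ⟨φ, hφ⟩ := extClass_surjective (res J j.unop.unop) i M y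
  refine ⟨j.unop.unop, φ, ?_⟩
  rw [← hy, ← hφ]
  rfl

lemma cl_trans {n m : ℕ} (h : n ≤ m) {i : ℕ} {M : ModuleCat.{0} R}
    (φ : cocycles (res J n).complex i M) :
    cl J m i M (cocyclesMap (trans J h) i (𝟙 M) φ) = cl J n i M φ := by
  have h1 := ext_map_extClass (quotPowMap J h) (res J m) (res J n) (trans J h) (trans_comm J h)
    i M φ
  have h2 := Limits.colimit.w (diagram (idealPowersDiagram J) i)
    (homOfLE h).op.op
  have h3 := congrArg (fun f : (diagram (idealPowersDiagram J) i).obj (op (op n)) ⟶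
    Limits.colimit (diagram (idealPowersDiagram J) i) =>
      (f.app M).hom (extClass (res J n) i M φ)) h2
  refine Eq.trans ?_ h3
  exact congrArg ((Limits.colimit.ι (diagram (idealPowersDiagram J) i) (op (op m))).app M).hom
    h1.symm

lemma map_cl {n i : ℕ} {M N : ModuleCat.{0} R} (f : M ⟶ N)
    (φ : cocycles (res J n).complex i M) :
    (localCohomology J i).map f (cl J n i M φ) = cl J n i N (cocyclesMap (𝟙 _) i f φ) := by
  have h1 := ext_obj_map_extClass (res J n) i f φ
  have h2 := (Limits.colimit.ι (diagram (idealPowersDiagram J) i) (op (op n))).naturality f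
  have h3 := congrArg (fun f => f (extClass (res J n) i M φ)) h2
  refine Eq.trans h3.symm ?_
  exact congrArg ((Limits.colimit.ι (diagram (idealPowersDiagram J) i) (op (op n))).app N).hom h1

lemma exists_of_cl_eq_zero {n i : ℕ} {M : ModuleCat.{0} R}
    {φ : cocycles (res J n).complex i M} (h : cl J n i M φ = 0) (j : ℕ)
    (hj : (ComplexShape.down ℕ).next i = j) :
    ∃ (m : ℕ) (hm : n ≤ m) (ψ : (res J m).complex.X j ⟶ M),
      (trans J hm).f i ≫ φ.1 = (res J m).complex.d i j ≫ ψ := by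
  have h0 : ((Limits.colimit.ι (diagram (idealPowersDiagram J) i) (op (op n))).app M).hom
    (extClass (res J n) i M φ) = ((Limits.colimit.ι (diagram (idealPowersDiagram J) i)
      (op (op n))).app M).hom 0 := h.trans (map_zero _).symm
  obtain ⟨k, f, g, hfg⟩ := Limits.Concrete.isColimit_exists_of_rep_eq _ (isColimitEval J i M) _ _ h0
  have hk : n ≤ k.unop.unop := leOfHom f.unop.unop
  refine ⟨k.unop.unop, hk, ?_⟩
  have h1 := ext_map_extClass (quotPowMap J hk) (res J _) (res J n) (trans J hk) (trans_comm J hk)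
    i M φ
  have h2 := (h1.symm.trans hfg).trans (map_zero _)
  obtain ⟨ψ, hψ⟩ := (extClass_eq_zero_iff _ _ j hj).1 h2
  refine ⟨ψ, ?_⟩
  rw [← hψ, coe_cocyclesMap, Category.comp_id]

lemma cl_eq_zero {n i : ℕ} {M : ModuleCat.{0} R} (φ : cocycles (res J n).complex i M) (j : ℕ)
    (hj : (ComplexShape.down ℕ).next i = j) (ψ : (res J n).complex.X j ⟶ M)
    (h : φ.1 = (res J n).complex.d i j ≫ ψ) : cl J n i M φ = 0 := by
  have := (extClass_eq_zero_iff (res J n) φ j hj).2 ⟨ψ, h⟩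
  exact (congrArg ((Limits.colimit.ι (diagram (idealPowersDiagram J) i)
    (op (op n))).app M).hom this).trans (map_zero _)

end LocalCoh

namespace LocalCoh
open ExtCocycle localCohomology
variable {R : Type} [CommRing R]

/-- Local cohomology of an unbundled module. -/
abbrev LH (J : Ideal R) (i : ℕ) (M : Type) [AddCommGroup M] [Module R M] : Type :=
  (localCohomology J i).obj (ModuleCat.of R M)

section basic
variable {J : Ideal R} {M N L : Type} [AddCommGroup M] [Module R M] [AddCommGroup N] [Module R N]
  [AddCommGroup L] [Module R L]

/-- The terms of the chosen resolution of `R ⧸ J ^ n`. -/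
abbrev resX (J : Ideal R) (n i : ℕ) : ModuleCat.{0} R := (res J n).complex.X i

abbrev resD (J : Ideal R) (n i j : ℕ) : resX J n i ⟶ resX J n j := (res J n).complex.d i j

abbrev resT (J : Ideal R) {n m : ℕ} (h : n ≤ m) (i : ℕ) : resX J m i ⟶ resX J n i :=
  (trans J h).f i

/-- The class of a cocycle. -/
def cls {n i : ℕ} (φ : resX J n i ⟶ ModuleCat.of R M) (h : resD J n (i + 1) i ≫ φ = 0) :
    LH J i M := cl J n i _ ⟨φ, h⟩

def lmap (J : Ideal R) (i : ℕ) (f : M →ₗ[R] N) : LH J i M →ₗ[R] LH J i N :=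
  ((localCohomology J i).map (ModuleCat.ofHom f)).hom

lemma exists_cls {i : ℕ} (c : LH J i M) :
    ∃ (n : ℕ) (φ : resX J n i ⟶ ModuleCat.of R M) (h : _), cls φ h = c := by
  obtain ⟨n, φ, h⟩ := exists_cl c
  exact ⟨n, φ.1, φ.2, h⟩

lemma resT_d {n m : ℕ} (h : n ≤ m) (i j : ℕ) :
    resT J h i ≫ resD J n i j = resD J m i j ≫ resT J h j := (trans J h).comm i j

lemma d_resT_comp {n m : ℕ} (hm : n ≤ m) {i : ℕ} {φ : resX J n i ⟶ ModuleCat.of R M}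
    (h : resD J n (i + 1) i ≫ φ = 0) : resD J m (i + 1) i ≫ resT J hm i ≫ φ = 0 := by
  rw [← Category.assoc, ← resT_d, Category.assoc, h, Limits.comp_zero]

lemma cls_resT {n m : ℕ} (hm : n ≤ m) {i : ℕ} {φ : resX J n i ⟶ ModuleCat.of R M}
    (h : resD J n (i + 1) i ≫ φ = 0) :
    cls (resT J hm i ≫ φ) (d_resT_comp hm h) = cls φ h := by
  rw [cls, cls, ← cl_trans hm]
  congr 1

lemma cls_add {n i : ℕ} {φ ψ : resX J n i ⟶ ModuleCat.of R M} (h : resD J n (i + 1) i ≫ φ = 0)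
    (h' : resD J n (i + 1) i ≫ ψ = 0) (h'' : resD J n (i + 1) i ≫ (φ + ψ) = 0) :
    cls (φ + ψ) h'' = cls φ h + cls ψ h' := by
  rw [cls, cls, cls, ← map_add]; rfl

lemma cls_smul {n i : ℕ} (r : R) {φ : resX J n i ⟶ ModuleCat.of R M}
    (h : resD J n (i + 1) i ≫ φ = 0) (h'' : resD J n (i + 1) i ≫ (r • φ) = 0) :
    cls (r • φ) h'' = r • cls φ h := by
  rw [cls, cls, ← map_smul]; rfl

lemma cls_zero {n i : ℕ} (h : resD J n (i + 1) i ≫ (0 : resX J n i ⟶ ModuleCat.of R M) = 0) :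
    cls 0 h = 0 := by
  have : (⟨0, h⟩ : cocycles (res J n).complex i (ModuleCat.of R M)) = 0 := rfl
  rw [cls, this, map_zero]

lemma d_comp_hom {n i : ℕ} {φ : resX J n i ⟶ ModuleCat.of R M} (h : resD J n (i + 1) i ≫ φ = 0)
    (f : M →ₗ[R] N) : resD J n (i + 1) i ≫ φ ≫ ModuleCat.ofHom f = 0 := by
  rw [← Category.assoc, h, Limits.zero_comp]

lemma lmap_cls {n i : ℕ} {φ : resX J n i ⟶ ModuleCat.of R M} (h : resD J n (i + 1) i ≫ φ = 0)
    (f : M →ₗ[R] N) :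
    lmap J i f (cls φ h) = cls (φ ≫ ModuleCat.ofHom f) (d_comp_hom h f) := by
  rw [cls, cls]
  refine (map_cl _ _).trans ?_
  congr 1

lemma cls_eq_zero {n i : ℕ} {φ : resX J n i ⟶ ModuleCat.of R M} {h : resD J n (i + 1) i ≫ φ = 0}
    {j : ℕ} (hj : (ComplexShape.down ℕ).next i = j) (ψ : resX J n j ⟶ ModuleCat.of R M)
    (hψ : φ = resD J n i j ≫ ψ) : cls φ h = 0 :=
  cl_eq_zero _ j hj ψ hψ

lemma exists_of_cls_eq_zero {n i : ℕ} {φ : resX J n i ⟶ ModuleCat.of R M}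
    {h : resD J n (i + 1) i ≫ φ = 0} (h0 : cls φ h = 0) {j : ℕ}
    (hj : (ComplexShape.down ℕ).next i = j) :
    ∃ (m : ℕ) (hm : n ≤ m) (ψ : resX J m j ⟶ ModuleCat.of R M),
      resT J hm i ≫ φ = resD J m i j ≫ ψ :=
  exists_of_cl_eq_zero h0 j hj

lemma lmap_id (i : ℕ) (c : LH J i M) : lmap J i LinearMap.id c = c := by
  have : lmap J i (LinearMap.id : M →ₗ[R] M) = LinearMap.id :=
    congrArg ModuleCat.Hom.hom ((localCohomology J i).map_id (ModuleCat.of R M))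
  rw [this]; rfl

lemma lmap_comp (i : ℕ) (g : N →ₗ[R] L) (f : M →ₗ[R] N) (c : LH J i M) :
    lmap J i (g ∘ₗ f) c = lmap J i g (lmap J i f c) :=
  congrArg (fun k => k.hom c)
    ((localCohomology J i).map_comp (ModuleCat.ofHom f) (ModuleCat.ofHom g))

lemma lmap_smul (i : ℕ) (r : R) (f : M →ₗ[R] N) (c : LH J i M) :
    lmap J i (r • f) c = r • lmap J i f c := by
  obtain ⟨n, φ, h, rfl⟩ := exists_cls c
  rw [lmap_cls, lmap_cls, ← cls_smul r]
  · congr 1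
  · rw [Linear.comp_smul, d_comp_hom h, smul_zero]

lemma lmap_lsmul (i : ℕ) (r : R) (c : LH J i M) :
    lmap J i (LinearMap.lsmul R M r) c = r • c := by
  have : LinearMap.lsmul R M r = r • LinearMap.id := by ext; simp
  rw [this, lmap_smul, lmap_id]

lemma lmap_zero (i : ℕ) (c : LH J i M) : lmap J i (0 : M →ₗ[R] N) c = 0 := by
  have := lmap_smul i 0 (0 : M →ₗ[R] N) c
  rwa [zero_smul, zero_smul] at this

lemma subsingleton_LH [Subsingleton M] (i : ℕ) : Subsingleton (LH J i M) := by
  refine subsingleton_of_forall_eq 0 fun c => ?_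
  rw [← lmap_id i c, show (LinearMap.id : M →ₗ[R] M) = 0 from Subsingleton.elim _ _, lmap_zero]

def lequiv (J : Ideal R) (i : ℕ) (e : M ≃ₗ[R] N) : LH J i M ≃ₗ[R] LH J i N :=
  LinearEquiv.ofLinearMap (lmap J i e.toLinearMap) (lmap J i e.symm.toLinearMap)
    (by ext c; simp only [LinearMap.comp_apply, ← lmap_comp]; simp [lmap_id])
    (by ext c; simp only [LinearMap.comp_apply, ← lmap_comp]; simp [lmap_id])

end basic

section exactSeq
variable {J : Ideal R} {A B C : Type} [AddCommGroup A] [Module R A] [AddCommGroup B] [Module R B]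
  [AddCommGroup C] [Module R C] {f : A →ₗ[R] B} {g : B →ₗ[R] C}

lemma exists_lift_resX (hg : Function.Surjective g) {n i : ℕ}
    (φ : resX J n i ⟶ ModuleCat.of R C) :
    ∃ ψ : resX J n i ⟶ ModuleCat.of R B, ψ ≫ ModuleCat.ofHom g = φ := by
  have : Epi (ModuleCat.ofHom g) := (ModuleCat.epi_iff_surjective _).2 hg
  exact ⟨Projective.factorThru φ (ModuleCat.ofHom g), Projective.factorThru_comp _ _⟩

lemma exists_factor (hf : Function.Injective f) (hfg : Function.Exact f g)
    {X : ModuleCat.{0} R} (φ : X ⟶ ModuleCat.of R B) (h : φ ≫ ModuleCat.ofHom g = 0) :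
    ∃ θ : X ⟶ ModuleCat.of R A, θ ≫ ModuleCat.ofHom f = φ := by
  have hr : ∀ x, φ.hom x ∈ LinearMap.range f := fun x =>
    (hfg _).1 (congrArg (fun k => k.hom x) h)
  refine ⟨ModuleCat.ofHom ((LinearEquiv.ofInjective f hf).symm.toLinearMap ∘ₗ
    φ.hom.codRestrict _ hr), ?_⟩
  ext x
  have := (LinearEquiv.ofInjective f hf).apply_symm_apply ⟨φ.hom x, hr x⟩
  exact congrArg Subtype.val this

lemma comp_ofHom_injective (hf : Function.Injective f) {X : ModuleCat.{0} R}
    {φ ψ : X ⟶ ModuleCat.of R A} (h : φ ≫ ModuleCat.ofHom f = ψ ≫ ModuleCat.ofHom f) : φ = ψ := by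
  have : Mono (ModuleCat.ofHom f) := (ModuleCat.mono_iff_injective _).2 hf
  exact (cancel_mono (ModuleCat.ofHom f)).1 h

lemma comp_ofHom_eq_zero (hfg : Function.Exact f g) {X : ModuleCat.{0} R}
    (φ : X ⟶ ModuleCat.of R A) : (φ ≫ ModuleCat.ofHom f) ≫ ModuleCat.ofHom g = 0 := by
  ext x
  exact hfg.apply_apply_eq_zero _

theorem exact_lmap (hf : Function.Injective f) (hfg : Function.Exact f g)
    (hg : Function.Surjective g) (i : ℕ) : Function.Exact (lmap J i f) (lmap J i g) := by
  intro c
  constructor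
  · intro hc
    obtain ⟨n, φ, h, rfl⟩ := exists_cls c
    rw [lmap_cls] at hc
    obtain ⟨m, hm, ψ, hψ⟩ := exists_of_cls_eq_zero hc rfl
    obtain ⟨ψ', rfl⟩ := exists_lift_resX hg ψ
    have hd : resD J m (i + 1) i ≫ resD J m i ((ComplexShape.down ℕ).next i) = 0 :=
      HomologicalComplex.d_comp_d _ _ _ _
    obtain ⟨θ, hθ⟩ := exists_factor hf hfg (resT J hm i ≫ φ - resD J m i _ ≫ ψ') (by
      rw [Preadditive.sub_comp, Category.assoc, hψ, Category.assoc, sub_self])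
    have hdθ : resD J m (i + 1) i ≫ θ = 0 := by
      refine comp_ofHom_injective hf ?_
      rw [Category.assoc, hθ, Preadditive.comp_sub, d_resT_comp hm h, reassoc_of% hd]
      simp
    refine ⟨cls θ hdθ, ?_⟩
    have h2 : resD J m (i + 1) i ≫ resD J m i ((ComplexShape.down ℕ).next i) ≫ ψ' = 0 := by
      rw [reassoc_of% hd]; simp
    have h1 := cls_add (d_comp_hom hdθ f) h2 (by rw [hθ, sub_add_cancel, d_resT_comp hm h])
    rw [lmap_cls, ← cls_resT hm h]
    rw [cls_eq_zero (h := h2) rfl ψ' rfl, add_zero] at h1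
    rw [← h1]
    congr 1
    rw [hθ, sub_add_cancel]
  · rintro ⟨a, rfl⟩
    rw [← lmap_comp, hfg.linearMap_comp_eq_zero, lmap_zero]

/-- The graph of the connecting map, from cochain representatives. -/
def deltaRel (J : Ideal R) (f : A →ₗ[R] B) (g : B →ₗ[R] C) (i : ℕ) (c : LH J i C)
    (a : LH J (i + 1) A) : Prop :=
  ∃ (n : ℕ) (φ : resX J n i ⟶ ModuleCat.of R B) (θ : resX J n (i + 1) ⟶ ModuleCat.of R A)
    (hθ : resD J n (i + 1 + 1) (i + 1) ≫ θ = 0)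
    (hφ : resD J n (i + 1) i ≫ φ ≫ ModuleCat.ofHom g = 0),
    resD J n (i + 1) i ≫ φ = θ ≫ ModuleCat.ofHom f ∧
      cls (φ ≫ ModuleCat.ofHom g) hφ = c ∧ cls θ hθ = a

lemma deltaRel.exists_le {i : ℕ} {c : LH J i C} {a : LH J (i + 1) A} {n : ℕ}
    {φ : resX J n i ⟶ ModuleCat.of R B} {θ : resX J n (i + 1) ⟶ ModuleCat.of R A}
    (hθ : resD J n (i + 1 + 1) (i + 1) ≫ θ = 0)
    (hφ : resD J n (i + 1) i ≫ φ ≫ ModuleCat.ofHom g = 0)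
    (hd : resD J n (i + 1) i ≫ φ = θ ≫ ModuleCat.ofHom f)
    (hc : cls (φ ≫ ModuleCat.ofHom g) hφ = c) (ha : cls θ hθ = a) {m : ℕ} (hm : n ≤ m) :
    ∃ (φ : resX J m i ⟶ ModuleCat.of R B) (θ : resX J m (i + 1) ⟶ ModuleCat.of R A)
    (hθ : resD J m (i + 1 + 1) (i + 1) ≫ θ = 0)
    (hφ : resD J m (i + 1) i ≫ φ ≫ ModuleCat.ofHom g = 0),
    resD J m (i + 1) i ≫ φ = θ ≫ ModuleCat.ofHom f ∧
      cls (φ ≫ ModuleCat.ofHom g) hφ = c ∧ cls θ hθ = a := by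
  refine ⟨resT J hm i ≫ φ, resT J hm (i + 1) ≫ θ, d_resT_comp hm hθ, ?_, ?_, ?_, ?_⟩
  · rw [Category.assoc]
    exact d_resT_comp hm hφ
  · rw [Category.assoc, ← hd, ← Category.assoc, ← Category.assoc, resT_d]
  · subst hc
    simp only [Category.assoc, cls_resT hm hφ]
  · rw [cls_resT hm hθ, ha]

lemma deltaRel.add {i : ℕ} {c c' : LH J i C} {a a' : LH J (i + 1) A}
    (h : deltaRel J f g i c a) (h' : deltaRel J f g i c' a') :
    deltaRel J f g i (c + c') (a + a') := by
  obtain ⟨n, φ, θ, hθ, hφ, hd, hc, ha⟩ := h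
  obtain ⟨n', φ', θ', hθ', hφ', hd', hc', ha'⟩ := h'
  obtain ⟨φ, θ, hθ, hφ, hd, hc, ha⟩ := deltaRel.exists_le hθ hφ hd hc ha (le_max_left n n')
  obtain ⟨φ', θ', hθ', hφ', hd', hc', ha'⟩ :=
    deltaRel.exists_le hθ' hφ' hd' hc' ha' (le_max_right n n')
  refine ⟨_, φ + φ', θ + θ', ?_, ?_, ?_, ?_, ?_⟩
  · rw [Preadditive.comp_add, hθ, hθ', add_zero]
  · rw [Preadditive.add_comp, Preadditive.comp_add, hφ, hφ', add_zero]
  · rw [Preadditive.add_comp, Preadditive.comp_add, hd, hd']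
  · rw [← hc, ← hc', ← cls_add]
    · simp only [Preadditive.add_comp]
    · rw [Preadditive.comp_add, hφ, hφ', add_zero]
  · rw [← ha, ← ha', ← cls_add]

lemma deltaRel.smul {i : ℕ} (r : R) {c : LH J i C} {a : LH J (i + 1) A}
    (h : deltaRel J f g i c a) : deltaRel J f g i (r • c) (r • a) := by
  obtain ⟨n, φ, θ, hθ, hφ, hd, hc, ha⟩ := h
  refine ⟨n, r • φ, r • θ, ?_, ?_, ?_, ?_, ?_⟩
  · rw [Linear.comp_smul, hθ, smul_zero]
  · rw [Linear.smul_comp, Linear.comp_smul, hφ, smul_zero]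
  · rw [Linear.smul_comp, Linear.comp_smul, hd]
  · rw [← hc, ← cls_smul r hφ]
    · simp only [Linear.smul_comp]
    · rw [Linear.comp_smul, hφ, smul_zero]
  · rw [← ha, ← cls_smul]

lemma deltaRel.exists (hf : Function.Injective f) (hfg : Function.Exact f g)
    (hg : Function.Surjective g) {i : ℕ} (c : LH J i C) : ∃ a, deltaRel J f g i c a := by
  obtain ⟨n, φ, h, rfl⟩ := exists_cls c
  obtain ⟨φ, rfl⟩ := exists_lift_resX hg φ
  obtain ⟨θ, hθ⟩ := exists_factor hf hfg (resD J n (i + 1) i ≫ φ) (by rw [Category.assoc, h])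
  have hdθ : resD J n (i + 1 + 1) (i + 1) ≫ θ = 0 := by
    refine comp_ofHom_injective hf ?_
    rw [Category.assoc, hθ]
    simp
  exact ⟨cls θ hdθ, n, φ, θ, hdθ, h, hθ.symm, rfl, rfl⟩

lemma deltaRel.eq_zero (hf : Function.Injective f) (hfg : Function.Exact f g)
    (hg : Function.Surjective g) {i : ℕ} {a : LH J (i + 1) A} (h : deltaRel J f g i 0 a) :
    a = 0 := by
  obtain ⟨n, φ, θ, hθ, hφ, hd, hc, ha⟩ := h
  obtain ⟨m, hm, ψ, hψ⟩ := exists_of_cls_eq_zero hc rfl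
  obtain ⟨ψ', rfl⟩ := exists_lift_resX hg ψ
  obtain ⟨η, hη⟩ := exists_factor hf hfg (resT J hm i ≫ φ - resD J m i _ ≫ ψ') (by
      rw [Preadditive.sub_comp, Category.assoc, hψ, Category.assoc, sub_self])
  rw [← ha, ← cls_resT hm]
  refine cls_eq_zero (j := i) (by simp) η ?_
  refine comp_ofHom_injective hf ?_
  have hd' : resD J m (i + 1) i ≫ resD J m i ((ComplexShape.down ℕ).next i) = 0 :=
      HomologicalComplex.d_comp_d _ _ _ _
  rw [Category.assoc, Category.assoc, hη, ← hd, Preadditive.comp_sub, reassoc_of% hd',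
    Limits.zero_comp, sub_zero, ← Category.assoc, ← Category.assoc, resT_d]

/-- The long exact sequence of local cohomology at the connecting map. -/
theorem exists_delta (hf : Function.Injective f) (hfg : Function.Exact f g)
    (hg : Function.Surjective g) (i : ℕ) :
    ∃ δ : LH J i C →ₗ[R] LH J (i + 1) A, Function.Exact (lmap J i g) δ ∧
      Function.Exact δ (lmap J (i + 1) f) := by
  choose D hD using fun c : LH J i C => deltaRel.exists (J := J) hf hfg hg c
  have huniq : ∀ {c a a'}, deltaRel J f g i c a → deltaRel J f g i c a' → a = a' := by
    intro c a a' h h'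
    have := h.add (h'.smul (-1))
    rw [neg_one_smul, neg_one_smul, add_neg_cancel, ← sub_eq_add_neg] at this
    exact sub_eq_zero.1 (this.eq_zero hf hfg hg)
  refine ⟨{ toFun := D, map_add' := fun x y => huniq (hD _) ((hD x).add (hD y)),
            map_smul' := fun r x => huniq (hD _) ((hD x).smul r) }, ?_, ?_⟩
  · intro c
    constructor
    · intro hc
      have h := hD c
      rw [show D c = 0 from hc] at h
      obtain ⟨n, φ, θ, hθ, hφ, hd, hc, ha⟩ := h
      obtain ⟨m, hm, ψ, hψ⟩ := exists_of_cls_eq_zero ha (j := i) (by simp)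
      have h1 : resD J m (i + 1) i ≫ (resT J hm i ≫ φ - ψ ≫ ModuleCat.ofHom f) = 0 := by
        rw [Preadditive.comp_sub, ← Category.assoc, ← resT_d, Category.assoc, hd,
          ← Category.assoc, hψ, Category.assoc, sub_self]
      refine ⟨cls _ h1, ?_⟩
      rw [← hc, ← cls_resT hm, lmap_cls]
      congr 1
      rw [Preadditive.sub_comp, comp_ofHom_eq_zero hfg, sub_zero, Category.assoc]
    · rintro ⟨b, rfl⟩
      obtain ⟨n, φ, h, rfl⟩ := exists_cls b
      refine huniq (hD _) ⟨n, φ, 0, by simp, d_comp_hom h g, by rw [h]; simp, ?_, cls_zero _⟩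
      rw [lmap_cls]
  · intro a
    constructor
    · intro ha
      obtain ⟨n, θ, h, rfl⟩ := exists_cls a
      rw [lmap_cls] at ha
      obtain ⟨m, hm, ψ, hψ⟩ := exists_of_cls_eq_zero ha (j := i) (by simp)
      have h1 : resD J m (i + 1) i ≫ ψ ≫ ModuleCat.ofHom g = 0 := by
        rw [← Category.assoc, ← hψ, ← Category.assoc, comp_ofHom_eq_zero hfg]
      refine ⟨cls _ h1, huniq (hD _) ⟨m, ψ, resT J hm (i + 1) ≫ θ, d_resT_comp hm h, h1, ?_, rfl,
        cls_resT hm h⟩⟩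
      rw [← hψ, Category.assoc]
    · rintro ⟨c, rfl⟩
      obtain ⟨n, φ, θ, hθ, hφ, hd, hc, ha⟩ := hD c
      change lmap J (i + 1) f (D c) = 0
      rw [← ha, lmap_cls]
      exact cls_eq_zero (by simp) φ hd.symm

end exactSeq
end LocalCoh

namespace LocalCoh
open ExtCocycle localCohomology
variable {R : Type} [CommRing R] {J : Ideal R} {M N L : Type} [AddCommGroup M] [Module R M]
  [AddCommGroup N] [Module R N] [AddCommGroup L] [Module R L]

lemma subsingleton_LH_of_injective (h : Module.Injective R M) (i : ℕ) :
    Subsingleton (LH J (i + 1) M) := by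
  have : Injective (ModuleCat.of R M) := (Module.injective_iff_injective_object R M).1 h
  refine subsingleton_of_forall_eq 0 fun c => ?_
  obtain ⟨n, φ, hφ, rfl⟩ := exists_cls c
  have hex := (res J n).exact_succ i
  exact cls_eq_zero (j := i) (by simp) (hex.descToInjective φ hφ)
    (hex.comp_descToInjective φ hφ).symm

/-- The augmentation of the chosen resolution. -/
def resπ (J : Ideal R) (n : ℕ) : resX J n 0 ⟶ quotPow J n := (res J n).π.f 0

instance (n : ℕ) : Epi (resπ J n) := inferInstanceAs (Epi ((res J n).π.f 0))

lemma resT_resπ {n m : ℕ} (h : n ≤ m) :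
    resT J h 0 ≫ resπ J n = resπ J m ≫ quotPowMap J h := trans_comm J h

lemma resD_resπ (n : ℕ) : resD J n (0 + 1) 0 ≫ resπ J n = 0 := (res J n).complex_d_comp_π_f_zero

lemma smul_cls_eq_zero {n i : ℕ} {φ : resX J n i ⟶ ModuleCat.of R M}
    (h : resD J n (i + 1) i ≫ φ = 0) {r : R} (hr : r ∈ J ^ n) : r • cls φ h = 0 := by
  have hπ : r • resπ J n = 0 := by
    ext x
    change r • (resπ J n).hom x = 0
    obtain ⟨y, hy⟩ := Ideal.Quotient.mk_surjective ((resπ J n).hom x)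
    rw [← hy]
    exact Ideal.Quotient.eq_zero_iff_mem.2 (Ideal.mul_mem_right _ _ hr)
  let ψ : cocycles (res J n).complex i (ModuleCat.of R M) := ⟨φ, h⟩
  have e1 := ext_map_extClass (0 : quotPow J n ⟶ quotPow J n) (res J n) (res J n)
    (r • 𝟙 _) (by
      change (r • 𝟙 (resX J n 0)) ≫ resπ J n = resπ J n ≫ (0 : quotPow J n ⟶ quotPow J n)
      rw [Linear.smul_comp, Category.id_comp, hπ, Limits.comp_zero]) i (ModuleCat.of R M) ψ
  have e2 := ext_map_extClass (0 : quotPow J n ⟶ quotPow J n) (res J n) (res J n)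
    0 (by
      change (0 : resX J n 0 ⟶ resX J n 0) ≫ resπ J n =
        resπ J n ≫ (0 : quotPow J n ⟶ quotPow J n)
      rw [Limits.zero_comp, Limits.comp_zero]) i (ModuleCat.of R M) ψ
  have e3 : cocyclesMap (r • 𝟙 (res J n).complex) i (𝟙 (ModuleCat.of R M)) ψ = r • ψ := by
    apply Subtype.ext
    rw [coe_cocyclesMap, HomologicalComplex.smul_f_apply, HomologicalComplex.id_f]
    simp
  have e4 : cocyclesMap (0 : (res J n).complex ⟶ (res J n).complex) i (𝟙 (ModuleCat.of R M)) ψ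
      = 0 := by
    apply Subtype.ext
    rw [coe_cocyclesMap]
    simp
  rw [e3] at e1
  rw [e4, map_zero] at e2
  have e5 : extClass (res J n) i (ModuleCat.of R M) (r • ψ) = 0 := e1.symm.trans e2
  have e6 : r • cls φ h = cl J n i _ (r • ψ) := (map_smul _ _ _).symm
  rw [e6]
  exact (congrArg ((Limits.colimit.ι (diagram (idealPowersDiagram J) i)
    (op (op n))).app (ModuleCat.of R M)).hom e5).trans (map_zero _)

lemma exists_pow_smul_eq_zero {i : ℕ} (c : LH J i M) : ∃ n, ∀ r ∈ J ^ n, r • c = 0 := by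
  obtain ⟨n, φ, h, rfl⟩ := exists_cls c
  exact ⟨n, fun r hr => smul_cls_eq_zero h hr⟩

section zero

lemma d_π (n : ℕ) (f : quotPow J n ⟶ ModuleCat.of R M) :
    resD J n (0 + 1) 0 ≫ resπ J n ≫ f = 0 := by
  rw [← Category.assoc, resD_resπ, Limits.zero_comp]

/-- The element of the zeroth local cohomology attached to a map out of `R ⧸ J ^ n`. -/
def ofHomZero {n : ℕ} (u : (R ⧸ J ^ n) →ₗ[R] M) : LH J 0 M :=
  cls (resπ J n ≫ ModuleCat.ofHom u) (d_π n _)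

lemma exists_ofHomZero (c : LH J 0 M) : ∃ (n : ℕ) (u : (R ⧸ J ^ n) →ₗ[R] M), ofHomZero u = c := by
  obtain ⟨n, φ, h, rfl⟩ := exists_cls c
  obtain ⟨u, rfl⟩ : ∃ u : quotPow J n ⟶ ModuleCat.of R M, resπ J n ≫ u = φ :=
    ⟨_, (Limits.CokernelCofork.IsColimit.desc' ((res J n).isColimitCokernelCofork) φ h).2⟩
  exact ⟨n, u.hom, rfl⟩

lemma lmap_ofHomZero {n : ℕ} (u : (R ⧸ J ^ n) →ₗ[R] M) (f : M →ₗ[R] N) :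
    lmap J 0 f (ofHomZero u) = ofHomZero (f ∘ₗ u) := by
  rw [ofHomZero, lmap_cls]
  rfl

lemma ofHomZero_factor {n m : ℕ} (h : n ≤ m) (u : (R ⧸ J ^ n) →ₗ[R] M) :
    ofHomZero (u ∘ₗ (quotPowMap J h).hom) = ofHomZero u := by
  refine Eq.trans ?_ (cls_resT h (d_π n (ModuleCat.ofHom u)))
  rw [ofHomZero]
  congr 1
  rw [← Category.assoc (resT J h 0), resT_resπ, Category.assoc]
  rfl

lemma quotPowMap_mk {n m : ℕ} (h : n ≤ m) (r : R) :
    (quotPowMap J h).hom (Ideal.Quotient.mk _ r) = Ideal.Quotient.mk _ r := rfl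

lemma eq_zero_of_ofHomZero_eq_zero {n : ℕ} {u : (R ⧸ J ^ n) →ₗ[R] M} (h : ofHomZero u = 0) :
    u = 0 := by
  obtain ⟨m, hm, ψ, hψ⟩ := exists_of_cls_eq_zero h (j := 0) (by simp)
  have h0 : resD J m 0 0 = 0 := (res J m).complex.shape _ _ (by simp)
  rw [h0, Limits.zero_comp, ← Category.assoc, resT_resπ, Category.assoc] at hψ
  have h1 : quotPowMap J hm ≫ ModuleCat.ofHom u = 0 := by
    rw [← cancel_epi (resπ J m), Limits.comp_zero]
    exact hψ
  refine LinearMap.ext fun x => ?_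
  obtain ⟨y, rfl⟩ := Ideal.Quotient.mk_surjective x
  exact congrArg (fun k => k.hom (Ideal.Quotient.mk _ y)) h1

lemma ofHomZero_add {n : ℕ} (u v : (R ⧸ J ^ n) →ₗ[R] M) :
    ofHomZero (u + v) = ofHomZero u + ofHomZero v := by
  rw [ofHomZero, ofHomZero, ofHomZero, ← cls_add]
  · congr 1
  · rw [Preadditive.comp_add, d_π, d_π, add_zero]

lemma ofHomZero_smul {n : ℕ} (r : R) (u : (R ⧸ J ^ n) →ₗ[R] M) :
    ofHomZero (r • u) = r • ofHomZero u := by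
  rw [ofHomZero, ofHomZero, ← cls_smul r]
  · congr 1
  · rw [Linear.comp_smul, d_π, smul_zero]

/-- The map out of `R ⧸ J ^ n` given by an element killed by `J ^ n`. -/
def homOfElem {n : ℕ} (y : M) (h : ∀ r ∈ J ^ n, r • y = 0) : (R ⧸ J ^ n) →ₗ[R] M :=
  Submodule.liftQ (J ^ n) (LinearMap.toSpanSingleton R M y) fun r hr => h r hr

@[simp] lemma homOfElem_mk {n : ℕ} (y : M) (h : ∀ r ∈ J ^ n, r • y = 0) (r : R) :
    homOfElem y h (Ideal.Quotient.mk _ r) = r • y := rfl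

lemma hom_ext_one {n : ℕ} {u v : (R ⧸ J ^ n) →ₗ[R] M}
    (h : u (Ideal.Quotient.mk _ 1) = v (Ideal.Quotient.mk _ 1)) : u = v := by
  refine LinearMap.ext fun x => ?_
  obtain ⟨y, rfl⟩ := Ideal.Quotient.mk_surjective x
  have : (Ideal.Quotient.mk (J ^ n) y) = y • Ideal.Quotient.mk (J ^ n) 1 := by
    rw [← Ideal.Quotient.mk_eq_mk, ← Ideal.Quotient.mk_eq_mk, ← Submodule.Quotient.mk_smul,
      smul_eq_mul, mul_one]
  rw [this, map_smul, map_smul, h]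

lemma smul_hom_one {n : ℕ} (u : (R ⧸ J ^ n) →ₗ[R] M) {r : R} (hr : r ∈ J ^ n) :
    r • u (Ideal.Quotient.mk _ 1) = 0 := by
  rw [← map_smul, ← Ideal.Quotient.mk_eq_mk, ← Submodule.Quotient.mk_smul, smul_eq_mul, mul_one,
    Ideal.Quotient.mk_eq_mk, Ideal.Quotient.eq_zero_iff_mem.2 hr, map_zero]

variable (J M) in
/-- Every element is killed by a power of `J`. -/
def IsPowTorsion : Prop := ∀ y : M, ∃ n, ∀ r ∈ J ^ n, r • y = 0

lemma lmap_zero_surjective (hM : IsPowTorsion J M) {g : M →ₗ[R] N}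
    (hg : Function.Surjective g) : Function.Surjective (lmap J 0 g) := by
  intro c
  obtain ⟨n, u, rfl⟩ := exists_ofHomZero c
  obtain ⟨b, hb⟩ := hg (u (Ideal.Quotient.mk _ 1))
  obtain ⟨m, hm⟩ := hM b
  have hm' : ∀ r ∈ J ^ (max n m), r • b = 0 := fun r hr => hm r
    (Ideal.pow_le_pow_right (le_max_right n m) hr)
  refine ⟨ofHomZero (homOfElem b hm'), ?_⟩
  rw [lmap_ofHomZero, ← ofHomZero_factor (le_max_left n m)]
  congr 1
  refine hom_ext_one ?_
  rw [LinearMap.comp_apply, LinearMap.comp_apply, quotPowMap_mk, homOfElem_mk, one_smul, hb]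

lemma subsingleton_LH_zero (h : ∀ y : M, (∃ n, ∀ r ∈ J ^ n, r • y = 0) → y = 0) :
    Subsingleton (LH J 0 M) := by
  refine subsingleton_of_forall_eq 0 fun c => ?_
  obtain ⟨n, u, rfl⟩ := exists_ofHomZero c
  have : u = 0 := hom_ext_one (h _ ⟨n, fun r hr => smul_hom_one u hr⟩)
  have h0 := ofHomZero_smul 0 u
  rwa [zero_smul, zero_smul, ← this] at h0

lemma nontrivial_LH_zero {y : M} (hy : y ≠ 0) {n : ℕ} (h : ∀ r ∈ J ^ n, r • y = 0) :
    Nontrivial (LH J 0 M) := by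
  refine nontrivial_of_ne (ofHomZero (homOfElem y h)) 0 fun h0 => hy ?_
  have := eq_zero_of_ofHomZero_eq_zero h0
  rw [← one_smul R y, ← homOfElem_mk y h 1, this, LinearMap.zero_apply]

/-- If `J` kills `M` then the zeroth local cohomology of `M` is a quotient of `M`. -/
lemma exists_surjective_LH_zero (h : ∀ r ∈ J, ∀ y : M, r • y = 0) :
    ∃ e : M →ₗ[R] LH J 0 M, Function.Surjective e := by
  have h' : ∀ y : M, ∀ r ∈ J ^ 1, r • y = 0 := fun y r hr => h r (by simpa using hr) y
  refine ⟨{ toFun := fun y => ofHomZero (homOfElem y (h' y)), map_add' := ?_, map_smul' := ?_ }, ?_⟩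
  · intro x y
    rw [← ofHomZero_add]
    congr 1
    refine hom_ext_one ?_
    simp only [LinearMap.add_apply, homOfElem_mk, one_smul]
  · intro r y
    rw [RingHom.id_apply, ← ofHomZero_smul]
    congr 1
    refine hom_ext_one ?_
    simp only [LinearMap.smul_apply, homOfElem_mk, one_smul]
  · intro c
    obtain ⟨n, u, rfl⟩ := exists_ofHomZero c
    refine ⟨u (Ideal.Quotient.mk _ 1), ?_⟩
    change ofHomZero (homOfElem _ _) = _
    rw [← ofHomZero_factor (le_max_left 1 n), ← ofHomZero_factor (le_max_right 1 n)]
    congr 1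
    refine hom_ext_one ?_
    rw [LinearMap.comp_apply, LinearMap.comp_apply, quotPowMap_mk, quotPowMap_mk, homOfElem_mk,
      one_smul]

end zero

section torsion

variable (J M) in
/-- The submodule of elements killed by a power of `J`. -/
def powTorsion : Submodule R M where
  carrier := {y | ∃ n, ∀ r ∈ J ^ n, r • y = 0}
  add_mem' := by
    rintro x y ⟨n, hn⟩ ⟨m, hm⟩
    refine ⟨max n m, fun r hr => ?_⟩
    rw [smul_add, hn r (Ideal.pow_le_pow_right (le_max_left n m) hr),
      hm r (Ideal.pow_le_pow_right (le_max_right n m) hr), add_zero]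
  zero_mem' := ⟨0, fun r _ => smul_zero r⟩
  smul_mem' := by
    rintro s x ⟨n, hn⟩
    exact ⟨n, fun r hr => by rw [smul_comm, hn r hr, smul_zero]⟩

lemma isPowTorsion_powTorsion : IsPowTorsion J (powTorsion J M) := by
  rintro ⟨y, n, hn⟩
  exact ⟨n, fun r hr => Subtype.ext (hn r hr)⟩

lemma IsPowTorsion.of_surjective (hM : IsPowTorsion J M) {g : M →ₗ[R] N}
    (hg : Function.Surjective g) : IsPowTorsion J N := by
  intro y
  obtain ⟨x, rfl⟩ := hg y
  obtain ⟨n, hn⟩ := hM x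
  exact ⟨n, fun r hr => by rw [← map_smul, hn r hr, map_zero]⟩

lemma exists_pow_of_fg [Module.Finite R M] (hM : IsPowTorsion J M) :
    ∃ n, ∀ r ∈ J ^ n, ∀ y : M, r • y = 0 := by
  obtain ⟨s, hs⟩ := Module.Finite.fg_top (R := R) (M := M)
  choose k hk using hM
  refine ⟨s.sup k, fun r hr y => ?_⟩
  have hy : y ∈ Submodule.span R (s : Set M) := hs ▸ Submodule.mem_top
  induction hy using Submodule.span_induction with
  | mem x hx => exact hk x r (Ideal.pow_le_pow_right (Finset.le_sup hx) hr)
  | zero => exact smul_zero r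
  | add x y _ _ hx hy => rw [smul_add, hx, hy, add_zero]
  | smul a x _ hx => rw [smul_comm, hx, smul_zero]

/-- Over a Noetherian ring the `J`-power torsion of an injective module is injective. -/
lemma injective_powTorsion [IsNoetherianRing R] (hM : Module.Injective R M) :
    Module.Injective R (powTorsion J M) := by
  refine Module.Baer.injective fun a g => ?_
  have htor : IsPowTorsion J (LinearMap.range g) := by
    rintro ⟨y, hy⟩
    obtain ⟨n, hn⟩ := isPowTorsion_powTorsion y
    exact ⟨n, fun r hr => Subtype.ext (hn r hr)⟩
  obtain ⟨k, hk⟩ := exists_pow_of_fg htor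
  have hk' : ∀ r ∈ J ^ k, ∀ x : a, g (r • x) = 0 := fun r hr x => by
    rw [map_smul]
    exact congrArg Subtype.val (hk r hr ⟨g x, x, rfl⟩)
  have hker : J ^ k • (⊤ : Submodule R a) ≤ LinearMap.ker g :=
    Submodule.smul_le.2 fun r hr x _ => hk' r hr x
  obtain ⟨n₀, hn₀⟩ := Ideal.exists_pow_inf_eq_pow_smul J (M := R) a
  have hn := hn₀ (n₀ + k) (Nat.le_add_right _ _)
  rw [Nat.add_sub_cancel_left] at hn
  set n := n₀ + k
  let f : a →ₗ[R] (R ⧸ J ^ n) := (J ^ n).mkQ ∘ₗ a.subtype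
  have hfg : LinearMap.ker f ≤ LinearMap.ker ((powTorsion J M).subtype ∘ₗ g) := by
    intro x hx
    have hx1 : (x : R) ∈ J ^ n := by
      exact (Submodule.Quotient.mk_eq_zero _).1 (show Submodule.Quotient.mk (p := J ^ n) (x : R) = 0 from hx)
    have hx2 : (x : R) ∈ J ^ n • (⊤ : Submodule R R) ⊓ a := ⟨by simpa using hx1, x.2⟩
    rw [hn] at hx2
    have hx3 : (x : R) ∈ (J ^ k • (⊤ : Submodule R a)).map a.subtype := by
      rw [Submodule.map_smul'', Submodule.map_top, Submodule.range_subtype]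
      exact (smul_mono_right (J ^ k) inf_le_right :
        J ^ k • (J ^ n₀ • (⊤ : Submodule R R) ⊓ a) ≤ J ^ k • a) hx2
    obtain ⟨x', hx', hxx⟩ := hx3
    have : x' = x := Subtype.ext hxx
    subst this
    have : g x' = 0 := hker hx'
    simp [this]
  obtain ⟨h, hh⟩ := hM.out ((LinearMap.ker f).liftQ f le_rfl)
    (LinearMap.ker_eq_bot.1 (Submodule.ker_liftQ_eq_bot _ _ _ le_rfl))
    ((LinearMap.ker f).liftQ _ hfg)
  have hmem : ∀ r, h ((J ^ n).mkQ r) ∈ powTorsion J M := fun r =>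
    ⟨n, fun s hs => by
      rw [← map_smul, ← map_smul, Submodule.mkQ_apply,
        (Submodule.Quotient.mk_eq_zero _).2, map_zero]
      exact Ideal.mul_mem_right _ _ hs⟩
  refine ⟨(h ∘ₗ (J ^ n).mkQ).codRestrict _ hmem, fun x hx => Subtype.ext ?_⟩
  exact hh (Submodule.Quotient.mk ⟨x, hx⟩)

/-- Higher local cohomology of a torsion module vanishes. -/
theorem subsingleton_LH_of_isPowTorsion [IsNoetherianRing R] (i : ℕ) :
    ∀ (M : Type) [AddCommGroup M] [Module R M], IsPowTorsion J M →
      Subsingleton (LH J (i + 1) M) := by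
  induction i with
  | zero =>
    intro M _ _ hM
    obtain ⟨⟨I, hI, f, hf⟩⟩ := EnoughInjectives.presentation (ModuleCat.of R M)
    have hI' : Module.Injective R I := (Module.injective_iff_injective_object R I).2 hI
    have hf' : Function.Injective f.hom := (ModuleCat.mono_iff_injective f).1 hf
    have hmem : ∀ y : M, f.hom y ∈ powTorsion J I := fun y => by
      obtain ⟨n, hn⟩ := hM y
      exact ⟨n, fun r hr => by rw [← map_smul]; exact (congrArg f.hom (hn r hr)).trans (map_zero _)⟩
    let f' : M →ₗ[R] powTorsion J I := f.hom.codRestrict _ hmem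
    have hf'' : Function.Injective f' := fun x y h => hf' (congrArg Subtype.val h)
    obtain ⟨δ, h1, h2⟩ := exists_delta (J := J) hf'' (LinearMap.exact_map_mkQ_range f')
      (Submodule.mkQ_surjective _) 0
    have hs := subsingleton_LH_of_injective (J := J) (injective_powTorsion (J := J) hI') 0
    have hsurj := lmap_zero_surjective (J := J) isPowTorsion_powTorsion
      (Submodule.mkQ_surjective (LinearMap.range f'))
    refine subsingleton_of_forall_eq 0 fun c => ?_
    obtain ⟨b, rfl⟩ := (h2 c).1 (Subsingleton.elim _ _)
    exact (h1 b).2 (hsurj b)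
  | succ i ih =>
    intro M _ _ hM
    obtain ⟨⟨I, hI, f, hf⟩⟩ := EnoughInjectives.presentation (ModuleCat.of R M)
    have hI' : Module.Injective R I := (Module.injective_iff_injective_object R I).2 hI
    have hf' : Function.Injective f.hom := (ModuleCat.mono_iff_injective f).1 hf
    have hmem : ∀ y : M, f.hom y ∈ powTorsion J I := fun y => by
      obtain ⟨n, hn⟩ := hM y
      exact ⟨n, fun r hr => by rw [← map_smul]; exact (congrArg f.hom (hn r hr)).trans (map_zero _)⟩
    let f' : M →ₗ[R] powTorsion J I := f.hom.codRestrict _ hmem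
    have hf'' : Function.Injective f' := fun x y h => hf' (congrArg Subtype.val h)
    obtain ⟨δ, h1, h2⟩ := exists_delta (J := J) hf'' (LinearMap.exact_map_mkQ_range f')
      (Submodule.mkQ_surjective _) (i + 1)
    have hs := subsingleton_LH_of_injective (J := J) (injective_powTorsion (J := J) hI') (i + 1)
    have hs' := ih _ (isPowTorsion_powTorsion.of_surjective (J := J)
      (Submodule.mkQ_surjective (LinearMap.range f')))
    refine subsingleton_of_forall_eq 0 fun c => ?_
    obtain ⟨b, rfl⟩ := (h2 c).1 (Subsingleton.elim _ _)
    rw [Subsingleton.elim b 0, map_zero]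

end torsion
end LocalCoh

section artinian
variable {R : Type*} [CommRing R] {A : Type*} [AddCommGroup A] [Module R A]

open Submodule in
/-- **Melkersson's criterion.** An `x`-power torsion module is Artinian as soon as the submodule
killed by `x` is. -/
theorem isArtinian_of_torsionBy (x : R) (hx : ∀ a : A, ∃ k : ℕ, x ^ k • a = 0)
    (hK : IsArtinian R (torsionBy R A x)) : IsArtinian R A := by
  have hKk : ∀ k : ℕ, IsArtinian R (torsionBy R A (x ^ k)) := by
    intro k
    induction k with
    | zero =>
      have : Subsingleton (torsionBy R A (x ^ 0)) := by
        rw [pow_zero, torsionBy_one]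
        infer_instance
      infer_instance
    | succ k ih =>
      have h1 : ∀ y ∈ torsionBy R A (x ^ (k + 1)), (LinearMap.lsmul R A x) y ∈
          torsionBy R A (x ^ k) := fun y hy => by
        rw [mem_torsionBy_iff, LinearMap.lsmul_apply, smul_smul, ← pow_succ]
        exact hy
      have h2 : torsionBy R A x ≤ torsionBy R A (x ^ (k + 1)) := fun y hy => by
        rw [mem_torsionBy_iff, pow_succ, mul_smul, (mem_torsionBy_iff _ _).1 hy, smul_zero]
      refine isArtinian_of_range_eq_ker (inclusion h2)
        ((LinearMap.lsmul R A x).restrict h1) ?_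
      ext ⟨y, hy⟩
      rw [LinearMap.mem_range, LinearMap.mem_ker]
      constructor
      · rintro ⟨z, hz⟩
        rw [← hz]
        exact Subtype.ext z.2
      · intro h
        exact ⟨⟨y, congrArg Subtype.val h⟩, rfl⟩
  rw [← monotone_stabilizes_iff_artinian]
  intro N
  let N' : ℕ → Submodule R A := fun i => OrderDual.ofDual (N i)
  have hN : ∀ {i j}, i ≤ j → N' j ≤ N' i := fun h => N.monotone h
  let T : ℕ → ℕ → Submodule R (torsionBy R A x) := fun k i =>
    ((N' i ⊓ torsionBy R A (x ^ (k + 1))).map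
      (LinearMap.lsmul R A (x ^ k))).comap (torsionBy R A x).subtype
  have hTi : ∀ k {i j}, i ≤ j → T k j ≤ T k i := fun k i j h =>
    comap_mono (map_mono (inf_le_inf_right _ (hN h)))
  have hTk' : ∀ i k, T (k + 1) i ≤ T k i := by
    rintro i k ⟨z, hz⟩ ⟨y, ⟨hy1, hy2⟩, hy3⟩
    refine ⟨x • y, ⟨smul_mem _ _ hy1, ?_⟩, ?_⟩
    · refine (mem_torsionBy_iff _ _).2 ?_
      rw [smul_smul, ← pow_succ]
      exact hy2
    · rw [LinearMap.lsmul_apply, smul_smul, ← pow_succ]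
      exact hy3
  have hTk : ∀ i {k l}, k ≤ l → T l i ≤ T k i := fun i k l h =>
    antitone_nat_of_succ_le (f := fun k => T k i) (hTk' i) h
  obtain ⟨k₀, hk₀⟩ := IsArtinian.monotone_stabilizes (R := R) (M := torsionBy R A x)
    ⟨fun n => OrderDual.toDual (T n n), fun i j h => (hTi j h).trans (hTk i h)⟩
  replace hk₀ : ∀ m, k₀ ≤ m → T k₀ k₀ = T m m := hk₀
  obtain ⟨i₀, hi₀⟩ := IsArtinian.monotone_stabilizes (R := R) (M := torsionBy R A (x ^ k₀))
    ⟨fun n => OrderDual.toDual ((N' n).comap (torsionBy R A (x ^ k₀)).subtype),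
      fun i j h => comap_mono (hN h)⟩
  replace hi₀ : ∀ m, i₀ ≤ m → (N' i₀).comap (torsionBy R A (x ^ k₀)).subtype =
    (N' m).comap (torsionBy R A (x ^ k₀)).subtype := hi₀
  have hT : ∀ k i j, k₀ ≤ k → k₀ ≤ i → T k i ≤ T k j := by
    intro k i j hk hi
    have h1 : T k i ≤ T k₀ k₀ := (hTi k hi).trans (hTk k₀ hk)
    rw [hk₀ (max k j) (le_max_of_le_left hk)] at h1
    exact h1.trans ((hTi _ (le_max_right _ _)).trans (hTk _ (le_max_left _ _)))
  refine ⟨max k₀ i₀, fun m hm => ?_⟩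
  refine le_antisymm (N.monotone hm) ?_
  change N' (max k₀ i₀) ≤ N' m
  have key : ∀ k, ∀ a ∈ N' (max k₀ i₀), x ^ (k₀ + k) • a = 0 → a ∈ N' m := by
    intro k
    induction k with
    | zero =>
      intro a ha hak
      have : (⟨a, hak⟩ : torsionBy R A (x ^ k₀)) ∈
        (N' i₀).comap (torsionBy R A (x ^ k₀)).subtype := hN (le_max_right _ _) ha
      rw [hi₀ m ((le_max_right _ _).trans hm)] at this
      exact this
    | succ k ih =>
      intro a ha hak
      have h1 : x ^ (k₀ + k) • a ∈ torsionBy R A x := by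
        rw [mem_torsionBy_iff, smul_smul, ← pow_succ']
        exact hak
      have h2 : (⟨_, h1⟩ : torsionBy R A x) ∈ T (k₀ + k) (max k₀ i₀) := ⟨a, ⟨ha, hak⟩, rfl⟩
      obtain ⟨b, ⟨hb1, hb2⟩, hb3⟩ := hT _ _ m (Nat.le_add_right _ _) (le_max_left _ _) h2
      have h3 := ih (a - b) (sub_mem ha (hN hm hb1)) (by
        rw [smul_sub, sub_eq_zero]
        exact hb3.symm)
      simpa using add_mem h3 hb1
  intro a ha
  obtain ⟨k, hk⟩ := hx a
  exact key k a ha (by rw [pow_add, mul_smul, hk, smul_zero])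

end artinian

section vanishing
open LocalCoh
variable {R : Type} [CommRing R]

/-- The quotient of `R ⧸ q` by the multiples of `x`. -/
abbrev QuotBy (q : Ideal R) (x : R) : Type :=
  (R ⧸ q) ⧸ LinearMap.range (LinearMap.lsmul R (R ⧸ q) x)

lemma lsmul_quotient_injective {q : Ideal R} [q.IsPrime] {x : R} (hx : x ∉ q) :
    Function.Injective (LinearMap.lsmul R (R ⧸ q) x) := by
  rw [injective_iff_map_eq_zero]
  intro y hy
  obtain ⟨z, rfl⟩ := Ideal.Quotient.mk_surjective y
  have : x * z ∈ q := Ideal.Quotient.eq_zero_iff_mem.1 hy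
  exact Ideal.Quotient.eq_zero_iff_mem.2 ((Ideal.IsPrime.mem_or_mem ‹_› this).resolve_left hx)

lemma mem_support_quotient {q : Ideal R} {p : PrimeSpectrum R} :
    p ∈ Module.support R (R ⧸ q) ↔ q ≤ p.asIdeal := by
  rw [Module.mem_support_iff_of_finite, Ideal.annihilator_quotient]

lemma le_of_mem_support_quotBy {q : Ideal R} {x : R} {p : PrimeSpectrum R}
    (hp : p ∈ Module.support R (QuotBy q x)) : q ≤ p.asIdeal :=
  mem_support_quotient.1
    (Module.support_subset_of_surjective _ (Submodule.mkQ_surjective _) hp)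

lemma mem_of_mem_support_quotBy {q : Ideal R} {x : R} {p : PrimeSpectrum R}
    (hp : p ∈ Module.support R (QuotBy q x)) : x ∈ p.asIdeal := by
  refine Module.annihilator_le_of_mem_support hp (Module.mem_annihilator.2 fun y => ?_)
  obtain ⟨z, rfl⟩ := Submodule.mkQ_surjective _ y
  rw [← map_smul]
  exact (Submodule.Quotient.mk_eq_zero _).2 ⟨z, rfl⟩

variable [IsLocalRing R]

/-- Local cohomology at the maximal ideal. -/
abbrev HM (n : ℕ) (M : Type) [AddCommGroup M] [Module R M] : Type := LH (maximalIdeal R) n M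

lemma exists_pow_smul_HM {n : ℕ} {M : Type} [AddCommGroup M] [Module R M] (x : R)
    (hx : x ∈ maximalIdeal R) (c : HM (R := R) n M) : ∃ k : ℕ, x ^ k • c = 0 := by
  obtain ⟨k, hk⟩ := exists_pow_smul_eq_zero c
  exact ⟨k, hk _ (Ideal.pow_mem_pow hx k)⟩

lemma exists_notMem_of_ne {q : Ideal R} [hq : q.IsPrime] (h : q ≠ maximalIdeal R) :
    ∃ x ∈ maximalIdeal R, x ∉ q :=
  SetLike.exists_of_lt (lt_of_le_of_ne (le_maximalIdeal hq.ne_top) h)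

lemma subsingleton_HM_zero_quotient {q : Ideal R} [hq : q.IsPrime] (h : q ≠ maximalIdeal R) :
    Subsingleton (HM (R := R) 0 (R ⧸ q)) := by
  obtain ⟨x, hx, hxq⟩ := exists_notMem_of_ne h
  refine subsingleton_LH_zero fun y ⟨n, hn⟩ => ?_
  have hxn : x ^ n ∉ q := fun h => hxq (hq.mem_of_pow_mem n h)
  exact (injective_iff_map_eq_zero _).1 (lsmul_quotient_injective hxn) y
    (hn _ (Ideal.pow_mem_pow hx n))

variable [IsNoetherianRing R]

lemma subsingleton_HM_succ_residue (n : ℕ) :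
    Subsingleton (HM (R := R) (n + 1) (R ⧸ maximalIdeal R)) := by
  refine subsingleton_LH_of_isPowTorsion n _ fun y => ⟨1, fun r hr => ?_⟩
  obtain ⟨z, rfl⟩ := Ideal.Quotient.mk_surjective y
  rw [pow_one] at hr
  exact Ideal.Quotient.eq_zero_iff_mem.2 (Ideal.mul_mem_right _ _ hr)

/-- Grothendieck vanishing. -/
theorem subsingleton_HM (n : ℕ) : ∀ (M : Type) [AddCommGroup M] [Module R M] [Module.Finite R M],
    (∀ q ∈ Module.support R M, Order.coheight q < n) → Subsingleton (HM (R := R) n M) := by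
  induction n with
  | zero =>
    intro M _ _ _ h
    have : Subsingleton M := by
      rw [← Module.support_eq_empty_iff (R := R)]
      exact Set.eq_empty_of_forall_notMem fun q hq => by simpa using h q hq
    exact subsingleton_LH 0
  | succ n ih =>
    intro M _ _ hM
    induction hM using IsNoetherianRing.induction_on_isQuotientEquivQuotientPrime R with
    | subsingleton N => exact fun _ => subsingleton_LH _
    | quotient N q e =>
      intro h
      suffices hs : Subsingleton (HM (R := R) (n + 1) (R ⧸ q.asIdeal)) from
        (lequiv (maximalIdeal R) (n + 1) e).toEquiv.subsingleton
      rw [e.support_eq] at h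
      by_cases hq : q.asIdeal = maximalIdeal R
      · rw [hq]
        exact subsingleton_HM_succ_residue n
      obtain ⟨x, hx, hxq⟩ := exists_notMem_of_ne hq
      obtain ⟨δ, -, h2⟩ := exists_delta (J := maximalIdeal R) (lsmul_quotient_injective hxq)
        (LinearMap.exact_map_mkQ_range _) (Submodule.mkQ_surjective _) n
      have hs : Subsingleton (HM (R := R) n (QuotBy q.asIdeal x)) := by
        refine ih _ fun p hp => ?_
        have hlt : q < p := lt_of_le_of_ne (le_of_mem_support_quotBy hp) (by
          rintro rfl
          exact hxq (mem_of_mem_support_quotBy hp))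
        have h1 := (Order.coheight_add_one_le hlt).trans_lt
          (h q (mem_support_quotient.2 le_rfl))
        push_cast at h1
        exact lt_of_add_lt_add_right h1
      have hinj : ∀ c : HM (R := R) (n + 1) (R ⧸ q.asIdeal), x • c = 0 → c = 0 := by
        intro c hc
        rw [← lmap_lsmul] at hc
        obtain ⟨b, rfl⟩ := (h2 c).1 hc
        rw [Subsingleton.elim b 0, map_zero]
      refine subsingleton_of_forall_eq 0 fun c => ?_
      obtain ⟨k, hk⟩ := exists_pow_smul_HM x hx c
      induction k with
      | zero => simpa using hk
      | succ k ihk => exact ihk (hinj _ (by rw [smul_smul, ← pow_succ', hk]))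
    | exact N₁ N₂ N₃ f g hf hg hfg h₁ h₃ =>
      intro h
      rw [Module.support_of_exact hfg hf hg] at h
      have := h₁ fun q hq => h q (Or.inl hq)
      have := h₃ fun q hq => h q (Or.inr hq)
      refine subsingleton_of_forall_eq 0 fun c => ?_
      obtain ⟨b, rfl⟩ := (exact_lmap (J := maximalIdeal R) hf hfg hg (n + 1) c).1
        (Subsingleton.elim _ _)
      rw [Subsingleton.elim b 0, map_zero]

/-- Local cohomology at the maximal ideal of a finite module is Artinian. -/
theorem isArtinian_HM (n : ℕ) : ∀ (M : Type) [AddCommGroup M] [Module R M] [Module.Finite R M],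
    IsArtinian R (HM (R := R) n M) := by
  induction n with
  | zero =>
    intro M _ _ hM
    induction hM using IsNoetherianRing.induction_on_isQuotientEquivQuotientPrime R with
    | subsingleton N =>
      have : Subsingleton (HM (R := R) 0 N) := subsingleton_LH _
      infer_instance
    | quotient N q e =>
      suffices hs : IsArtinian R (HM (R := R) 0 (R ⧸ q.asIdeal)) from
        (lequiv (maximalIdeal R) 0 e).symm.isArtinian_iff.1 hs
      by_cases hq : q.asIdeal = maximalIdeal R
      · rw [hq]
        obtain ⟨f, hf⟩ := exists_surjective_LH_zero (J := maximalIdeal R)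
          (M := R ⧸ maximalIdeal R) (fun r hr y => by
            obtain ⟨z, rfl⟩ := Ideal.Quotient.mk_surjective y
            exact Ideal.Quotient.eq_zero_iff_mem.2 (Ideal.mul_mem_right _ _ hr))
        have : IsArtinian R (R ⧸ maximalIdeal R) := by
          have h1 : IsArtinianRing (R ⧸ maximalIdeal R) := by
            let _ := Ideal.Quotient.field (maximalIdeal R)
            infer_instance
          exact isArtinian_of_surjective_algebraMap (R := R ⧸ maximalIdeal R)
            (S := R) Ideal.Quotient.mk_surjective
        exact isArtinian_of_surjective _ f hf
      · have := subsingleton_HM_zero_quotient hq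
        infer_instance
    | exact N₁ N₂ N₃ f g hf hg hfg h₁ h₃ =>
      exact isArtinian_of_range_eq_ker (lmap (maximalIdeal R) 0 f) (lmap (maximalIdeal R) 0 g)
        (LinearMap.exact_iff.1 (exact_lmap hf hfg hg 0)).symm
  | succ n ih =>
    intro M _ _ hM
    induction hM using IsNoetherianRing.induction_on_isQuotientEquivQuotientPrime R with
    | subsingleton N =>
      have : Subsingleton (HM (R := R) (n + 1) N) := subsingleton_LH _
      infer_instance
    | quotient N q e =>
      suffices hs : IsArtinian R (HM (R := R) (n + 1) (R ⧸ q.asIdeal)) from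
        (lequiv (maximalIdeal R) (n + 1) e).symm.isArtinian_iff.1 hs
      by_cases hq : q.asIdeal = maximalIdeal R
      · rw [hq]
        have := subsingleton_HM_succ_residue (R := R) n
        infer_instance
      obtain ⟨x, hx, hxq⟩ := exists_notMem_of_ne hq
      obtain ⟨δ, -, h2⟩ := exists_delta (J := maximalIdeal R) (lsmul_quotient_injective hxq)
        (LinearMap.exact_map_mkQ_range _) (Submodule.mkQ_surjective _) n
      refine isArtinian_of_torsionBy x (exists_pow_smul_HM x hx) ?_
      have := ih (QuotBy q.asIdeal x)
      have hmem : ∀ b, δ b ∈ Submodule.torsionBy R (HM (R := R) (n + 1) (R ⧸ q.asIdeal)) x := by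
        intro b
        rw [Submodule.mem_torsionBy_iff, ← lmap_lsmul]
        exact (h2 _).2 ⟨b, rfl⟩
      refine isArtinian_of_surjective _ (δ.codRestrict _ hmem) ?_
      rintro ⟨c, hc⟩
      rw [Submodule.mem_torsionBy_iff, ← lmap_lsmul] at hc
      obtain ⟨b, rfl⟩ := (h2 _).1 hc
      exact ⟨b, rfl⟩
    | exact N₁ N₂ N₃ f g hf hg hfg h₁ h₃ =>
      exact isArtinian_of_range_eq_ker (lmap (maximalIdeal R) (n + 1) f)
        (lmap (maximalIdeal R) (n + 1) g)
        (LinearMap.exact_iff.1 (exact_lmap hf hfg hg (n + 1))).symm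

end vanishing

section attached
variable {R : Type} [CommRing R]

variable (R) in
/-- Every element of the ring acts on `Q` as zero or surjectively. -/
def ZeroOrSurjective (Q : Type) [AddCommGroup Q] [Module R Q] : Prop :=
  ∀ s : R, (∀ y : Q, s • y = 0) ∨ Function.Surjective fun y : Q => s • y

lemma ZeroOrSurjective.of_surjective {Q Q' : Type} [AddCommGroup Q] [Module R Q]
    [AddCommGroup Q'] [Module R Q'] (h : ZeroOrSurjective R Q) {g : Q →ₗ[R] Q'}
    (hg : Function.Surjective g) : ZeroOrSurjective R Q' := by
  intro s
  rcases h s with h | h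
  · left
    intro y
    obtain ⟨x, rfl⟩ := hg y
    rw [← map_smul, h, map_zero]
  · right
    intro y
    obtain ⟨x, rfl⟩ := hg y
    obtain ⟨z, rfl⟩ := h x
    exact ⟨g z, (map_smul g s z).symm⟩

lemma not_surjective_of_smul_eq_zero {Q : Type} [AddCommGroup Q] [Module R Q] [Nontrivial Q]
    {s : R} (h : ∀ y : Q, s • y = 0) : ¬ Function.Surjective fun y : Q => s • y := by
  intro h'
  obtain ⟨y, hy⟩ := exists_ne (0 : Q)
  obtain ⟨z, rfl⟩ := h' y
  exact hy (h z)

lemma ZeroOrSurjective.annihilator_eq {Q Q' : Type} [AddCommGroup Q] [Module R Q]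
    [AddCommGroup Q'] [Module R Q'] [Nontrivial Q'] (h : ZeroOrSurjective R Q) {g : Q →ₗ[R] Q'}
    (hg : Function.Surjective g) : Module.annihilator R Q' = Module.annihilator R Q := by
  refine le_antisymm (fun s hs => ?_) (g.annihilator_le_of_surjective hg)
  rw [Module.mem_annihilator] at hs ⊢
  refine (h s).resolve_right fun hsur => not_surjective_of_smul_eq_zero hs fun y => ?_
  obtain ⟨x, rfl⟩ := hg y
  obtain ⟨z, rfl⟩ := hsur x
  exact ⟨g z, (map_smul g s z).symm⟩

variable (R) in
/-- The annihilators of the nonzero quotients on which every ring element acts as zero or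
surjectively form a finite set. -/
def FiniteAnnihilators (A : Type) [AddCommGroup A] [Module R A] : Prop :=
  ∃ F : Set (Ideal R), F.Finite ∧ ∀ (Q : Type) [AddCommGroup Q] [Module R Q] [Nontrivial Q],
    ZeroOrSurjective R Q → ∀ g : A →ₗ[R] Q, Function.Surjective g → Module.annihilator R Q ∈ F

lemma FiniteAnnihilators.congr {A B : Type} [AddCommGroup A] [Module R A] [AddCommGroup B]
    [Module R B] (h : FiniteAnnihilators R A) (e : A ≃ₗ[R] B) : FiniteAnnihilators R B := by
  obtain ⟨F, hF, h⟩ := h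
  exact ⟨F, hF, fun Q _ _ _ hQ g hg => h Q hQ (g ∘ₗ e.toLinearMap) (hg.comp e.surjective)⟩

lemma FiniteAnnihilators.of_codisjoint {A : Type} [AddCommGroup A] [Module R A]
    {N₁ N₂ : Submodule R A} (hN : Codisjoint N₁ N₂) (h₁ : FiniteAnnihilators R N₁)
    (h₂ : FiniteAnnihilators R N₂) : FiniteAnnihilators R A := by
  obtain ⟨F₁, hF₁, h₁⟩ := h₁
  obtain ⟨F₂, hF₂, h₂⟩ := h₂
  refine ⟨F₁ ∪ F₂, hF₁.union hF₂, fun Q _ _ _ hQ g hg => ?_⟩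
  by_cases hs : Function.Surjective (g ∘ₗ N₁.subtype)
  · exact Or.inl (h₁ Q hQ _ hs)
  · right
    set K := LinearMap.range (g ∘ₗ N₁.subtype)
    have hK : K ≠ ⊤ := fun h => hs (LinearMap.range_eq_top.1 h)
    have : Nontrivial (Q ⧸ K) := Submodule.Quotient.nontrivial_iff.2 hK
    rw [← hQ.annihilator_eq (Submodule.mkQ_surjective K)]
    refine h₂ _ (hQ.of_surjective (Submodule.mkQ_surjective K)) (K.mkQ ∘ₗ g ∘ₗ N₂.subtype) ?_
    intro y
    obtain ⟨y, rfl⟩ := Submodule.mkQ_surjective _ y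
    obtain ⟨a, rfl⟩ := hg y
    obtain ⟨b, hb, c, hc, rfl⟩ := Submodule.mem_sup.1
      (hN.eq_top ▸ Submodule.mem_top : a ∈ N₁ ⊔ N₂)
    refine ⟨⟨c, hc⟩, ?_⟩
    have : K.mkQ (g b) = 0 := (Submodule.Quotient.mk_eq_zero _).2 ⟨⟨b, hb⟩, rfl⟩
    simp only [LinearMap.comp_apply, map_add, this, zero_add]
    rfl

lemma FiniteAnnihilators.of_secondary {A : Type} [AddCommGroup A] [Module R A]
    (h : ∀ s : R, (∃ k : ℕ, ∀ y : A, s ^ k • y = 0) ∨ Function.Surjective fun y : A => s • y) :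
    FiniteAnnihilators R A := by
  refine ⟨{(Module.annihilator R A).radical}, Set.finite_singleton _,
    fun Q _ _ _ hQ g hg => ?_⟩
  rw [Set.mem_singleton_iff]
  ext s
  rw [Ideal.mem_radical_iff]
  simp only [Module.mem_annihilator]
  constructor
  · intro hs
    refine (h s).resolve_right fun hsur => not_surjective_of_smul_eq_zero hs fun y => ?_
    obtain ⟨x, rfl⟩ := hg y
    obtain ⟨z, rfl⟩ := hsur x
    exact ⟨g z, (map_smul g s z).symm⟩
  · rintro ⟨k, hk⟩
    refine (hQ s).resolve_right fun hsur => ?_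
    have hk' : ∀ y : Q, s ^ k • y = 0 := fun y => by
      obtain ⟨x, rfl⟩ := hg y
      rw [← map_smul, hk, map_zero]
    refine not_surjective_of_smul_eq_zero hk' ?_
    have := hsur.iterate k
    rwa [smul_iterate] at this

theorem finiteAnnihilators_of_isArtinian (A : Type) [AddCommGroup A] [Module R A]
    [IsArtinian R A] : FiniteAnnihilators R A := by
  suffices h : ∀ N : Submodule R A, FiniteAnnihilators R N from
    (h ⊤).congr Submodule.topEquiv
  intro N
  induction N using IsArtinian.induction with
  | hgt N ih =>
    have ih' : ∀ K : Submodule R N, K ≠ ⊤ → FiniteAnnihilators R K := by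
      intro K hK
      refine (ih (K.map N.subtype) (lt_of_le_of_ne (Submodule.map_subtype_le _ _) fun h => hK ?_)).congr
        (K.equivMapOfInjective _ N.injective_subtype).symm
      have := congrArg (Submodule.comap N.subtype) h
      rwa [Submodule.comap_map_eq_of_injective N.injective_subtype,
        Submodule.comap_subtype_self] at this
    by_cases h : ∀ s : R, (∃ k : ℕ, ∀ y : N, s ^ k • y = 0) ∨
        Function.Surjective fun y : N => s • y
    · exact .of_secondary h
    push Not at h
    obtain ⟨s, hs1, hs2⟩ := h
    obtain ⟨k, hk, hk1⟩ := ((LinearMap.eventually_codisjoint_ker_pow_range_pow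
      (LinearMap.lsmul R N s)).and (Filter.eventually_ge_atTop 1)).exists
    have hpow : ∀ y, (LinearMap.lsmul R N s ^ k) y = s ^ k • y := fun y => by
      rw [Module.End.pow_apply]
      exact congrFun (smul_iterate s k) y
    refine .of_codisjoint hk (ih' _ fun h => ?_) (ih' _ fun h => hs2 fun y => ?_)
    · obtain ⟨y, hy⟩ := hs1 k
      refine hy ?_
      rw [← hpow]
      exact LinearMap.mem_ker.1 (h ▸ Submodule.mem_top)
    · obtain ⟨z, hz⟩ := LinearMap.range_eq_top.1 h y
      obtain ⟨k, rfl⟩ := Nat.exists_eq_add_of_le' hk1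
      rw [hpow, pow_succ', mul_smul] at hz
      exact ⟨_, hz⟩

end attached

section nonvanishing
open LocalCoh
variable {R : Type} [CommRing R] [IsLocalRing R] [IsNoetherianRing R]

lemma lmap_HM_surjective {n : ℕ} {M N : Type} [AddCommGroup M] [Module R M] [Module.Finite R M]
    [AddCommGroup N] [Module R N] {g : M →ₗ[R] N} (hg : Function.Surjective g)
    (h : ∀ q ∈ Module.support R (LinearMap.ker g), Order.coheight q < n + 1) :
    Function.Surjective (lmap (maximalIdeal R) n g) := by
  obtain ⟨δ, h1, -⟩ := exists_delta (J := maximalIdeal R)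
    (Submodule.injective_subtype (LinearMap.ker g)) (LinearMap.exact_subtype_ker_map g) hg n
  have := subsingleton_HM (n + 1) (LinearMap.ker g) (by exact_mod_cast h)
  exact fun c => (h1 c).1 (Subsingleton.elim _ _)

lemma coheight_lt_of_mem_support_quotBy {n : ℕ} {q p : PrimeSpectrum R} {x : R}
    (hq : Order.coheight q < n + 1) (hx : x ∉ q.asIdeal)
    (hp : p ∈ Module.support R (QuotBy q.asIdeal x)) : Order.coheight p < n := by
  have hlt : q < p := lt_of_le_of_ne (le_of_mem_support_quotBy hp) (by
    rintro rfl
    exact hx (mem_of_mem_support_quotBy hp))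
  exact lt_of_add_lt_add_right ((Order.coheight_add_one_le hlt).trans_lt hq)

lemma smul_HM_surjective {n : ℕ} {q : PrimeSpectrum R} (hq : Order.coheight q < n + 1) {x : R}
    (hx : x ∉ q.asIdeal) :
    Function.Surjective fun y : HM (R := R) n (R ⧸ q.asIdeal) => x • y := by
  have hs := subsingleton_HM n (QuotBy q.asIdeal x)
    fun p hp => coheight_lt_of_mem_support_quotBy hq hx hp
  intro c
  obtain ⟨b, hb⟩ := (exact_lmap (J := maximalIdeal R) (lsmul_quotient_injective hx)
    (LinearMap.exact_map_mkQ_range _) (Submodule.mkQ_surjective _) n c).1 (Subsingleton.elim _ _)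
  rw [lmap_lsmul] at hb
  exact ⟨b, hb⟩

lemma smul_HM_eq_zero {n : ℕ} {M : Type} [AddCommGroup M] [Module R M] {x : R}
    (hx : ∀ y : M, x • y = 0) (c : HM (R := R) n M) : x • c = 0 := by
  rw [← lmap_lsmul, show LinearMap.lsmul R M x = 0 from LinearMap.ext hx, lmap_zero]

lemma smul_quotient_eq_zero {q : Ideal R} {x : R} (hx : x ∈ q) (y : R ⧸ q) : x • y = 0 := by
  obtain ⟨z, rfl⟩ := Ideal.Quotient.mk_surjective y
  exact Ideal.Quotient.eq_zero_iff_mem.2 (Ideal.mul_mem_right _ _ hx)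

lemma zeroOrSurjective_HM {n : ℕ} {q : PrimeSpectrum R} (hq : Order.coheight q < n + 1) :
    ZeroOrSurjective R (HM (R := R) n (R ⧸ q.asIdeal)) := by
  intro s
  by_cases hs : s ∈ q.asIdeal
  · exact Or.inl fun y => smul_HM_eq_zero (fun y => smul_quotient_eq_zero hs y) y
  · exact Or.inr (smul_HM_surjective hq hs)

lemma annihilator_HM {n : ℕ} {q : PrimeSpectrum R} (hq : Order.coheight q < n + 1)
    [Nontrivial (HM (R := R) n (R ⧸ q.asIdeal))] :
    Module.annihilator R (HM (R := R) n (R ⧸ q.asIdeal)) = q.asIdeal := by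
  refine le_antisymm (fun s hs => ?_) fun s hs => ?_
  · by_contra hsq
    exact not_surjective_of_smul_eq_zero (Module.mem_annihilator.1 hs) (smul_HM_surjective hq hsq)
  · exact Module.mem_annihilator.2 fun y => smul_HM_eq_zero (fun y => smul_quotient_eq_zero hs y) y

lemma eq_maximalIdeal_of_coheight_eq_zero {q : PrimeSpectrum R} (h : Order.coheight q = 0) :
    q.asIdeal = maximalIdeal R := by
  have h1 : q ≤ closedPoint R := le_maximalIdeal q.2.ne_top
  have h2 : q = closedPoint R := le_antisymm h1 (Order.coheight_eq_zero.1 h h1)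
  rw [h2]
  rfl

lemma ne_maximalIdeal_of_coheight_pos {q : PrimeSpectrum R} (h : Order.coheight q ≠ 0) :
    q.asIdeal ≠ maximalIdeal R := by
  intro hq
  refine h (Order.coheight_eq_zero.2 fun p _ => ?_)
  change p.asIdeal ≤ q.asIdeal
  rw [hq]
  exact le_maximalIdeal p.2.ne_top

/-- Between a prime and a prime power of the maximal ideal: a prime of coheight one less through
a given element of the maximal ideal. -/
lemma exists_le_coheight_eq {q : PrimeSpectrum R} {e : ℕ} (hq : Order.coheight q = (e + 2 : ℕ))
    {x : R} (hx : x ∈ maximalIdeal R) :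
    ∃ q' : PrimeSpectrum R, q ≤ q' ∧ x ∈ q'.asIdeal ∧ (e + 1 : ℕ) ≤ Order.coheight q' := by
  obtain ⟨c, hc1, hc2⟩ := Order.exists_series_of_coheight_eq_coe q hq
  have hlast : c.last.asIdeal = maximalIdeal R := by
    by_contra hne
    have hlt : c.last < closedPoint R := lt_of_le_of_ne (le_maximalIdeal c.last.2.ne_top)
      fun h => hne (congrArg PrimeSpectrum.asIdeal h)
    have := Order.length_le_coheight (x := q) (p := c.snoc _ hlt) (by simp [hc1])
    rw [hq] at this
    simp only [RelSeries.snoc_length, hc2] at this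
    exact absurd (Nat.cast_le.1 this) (by omega)
  obtain ⟨c', h1, h2, h3, -⟩ := PrimeSpectrum.exist_ltSeries_mem_one_of_mem_last c
    (x := x) (hlast ▸ hx)
  have hlen : c'.length = e + 2 := h2 ▸ hc2
  have hone : ((1 : Fin (c'.length + 1)) : ℕ) = 1 := by
    rw [Fin.val_one', hlen]; rfl
  refine ⟨c' 1, ?_, h1, ?_⟩
  · rw [← hc1, h3]
    exact c'.strictMono.monotone (Fin.zero_le _)
  · have := Order.length_le_coheight (x := c' 1) (p := c'.drop 1) (by
      rw [RelSeries.head_drop])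
    rw [RelSeries.drop_length, hone] at this
    exact (Nat.cast_le.2 (by omega)).trans this

lemma exists_quotBy_surjective {q q' : Ideal R} (h : q ≤ q') {x : R} (hx : x ∈ q') :
    ∃ f : QuotBy q x →ₗ[R] R ⧸ q', Function.Surjective f := by
  refine ⟨Submodule.liftQ _ (Submodule.factor h) ?_, ?_⟩
  · rintro _ ⟨y, rfl⟩
    rw [LinearMap.mem_ker, LinearMap.lsmul_apply, map_smul]
    exact smul_quotient_eq_zero hx _
  · intro y
    obtain ⟨z, rfl⟩ := Submodule.factor_surjective h y
    exact ⟨Submodule.mkQ _ z, rfl⟩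

/-- Grothendieck nonvanishing for `R ⧸ q`. -/
theorem nontrivial_HM (n : ℕ) : ∀ q : PrimeSpectrum R, Order.coheight q = n →
    Nontrivial (HM (R := R) n (R ⧸ q.asIdeal)) := by
  induction n with
  | zero =>
    intro q hq
    have h1 := eq_maximalIdeal_of_coheight_eq_zero (by exact_mod_cast hq)
    have := q.2
    refine nontrivial_LH_zero (n := 1) (y := Ideal.Quotient.mk q.asIdeal 1) (by simp) ?_
    intro r hr
    rw [pow_one, ← h1] at hr
    exact smul_quotient_eq_zero hr _
  | succ n ih =>
    intro q hq
    have hqm : q.asIdeal ≠ maximalIdeal R :=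
      ne_maximalIdeal_of_coheight_pos (by rw [hq]; exact_mod_cast n.succ_ne_zero)
    cases n with
    | zero =>
      obtain ⟨x, hx, hxq⟩ := exists_notMem_of_ne hqm
      obtain ⟨f, hf⟩ := exists_quotBy_surjective (le_maximalIdeal q.2.ne_top) hx
      have : Nontrivial (QuotBy q.asIdeal x) := hf.nontrivial
      obtain ⟨p, hp⟩ := associatedPrimes.nonempty R (QuotBy q.asIdeal x)
      obtain ⟨hp', g, hg⟩ := (isAssociatedPrime_iff_exists_injective_linearMap p _).1 hp
      have hpm : p = maximalIdeal R := by
        refine eq_maximalIdeal_of_coheight_eq_zero (q := ⟨p, hp'⟩) ?_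
        have := coheight_lt_of_mem_support_quotBy (n := 1) (q := q) (p := ⟨p, hp'⟩)
          (by rw [hq]; norm_num) hxq
          (Module.support_subset_of_injective g hg (mem_support_quotient.2 le_rfl))
        exact Order.lt_one_iff.1 (by exact_mod_cast this)
      have hnt : Nontrivial (HM (R := R) 0 (QuotBy q.asIdeal x)) := by
        refine nontrivial_LH_zero (n := 1) (y := g (Ideal.Quotient.mk p 1)) ?_ ?_
        · rw [Ne, map_eq_zero_iff g hg]
          simp
        · intro r hr
          rw [pow_one, ← hpm] at hr
          rw [← map_smul, smul_quotient_eq_zero hr, map_zero]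
      obtain ⟨δ, h1, -⟩ := exists_delta (J := maximalIdeal R) (lsmul_quotient_injective hxq)
        (LinearMap.exact_map_mkQ_range _) (Submodule.mkQ_surjective _) 0
      have := subsingleton_HM_zero_quotient hqm
      refine Function.Injective.nontrivial (f := δ) ((injective_iff_map_eq_zero _).2 fun c hc => ?_)
      obtain ⟨b, rfl⟩ := (h1 c).1 hc
      rw [Subsingleton.elim b 0, map_zero]
    | succ e =>
      by_contra hcon
      rw [not_nontrivial_iff_subsingleton] at hcon
      have := isArtinian_HM (R := R) (e + 1) (R ⧸ q.asIdeal)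
      obtain ⟨F, hF, hF'⟩ := finiteAnnihilators_of_isArtinian (R := R)
        (HM (R := R) (e + 1) (R ⧸ q.asIdeal))
      obtain ⟨x, hx, hxF⟩ : ∃ x ∈ maximalIdeal R,
          ∀ p ∈ insert q.asIdeal F, p.IsPrime → p ≠ maximalIdeal R → x ∉ p := by
        by_contra! hall
        have hfin : {p ∈ insert q.asIdeal F | p.IsPrime ∧ p ≠ maximalIdeal R}.Finite :=
          (hF.insert _).subset (Set.sep_subset _ _)
        have hsub : (maximalIdeal R : Set R) ⊆
            ⋃ p ∈ (hfin.toFinset : Set (Ideal R)), (p : Set R) := by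
          intro x hx
          obtain ⟨p, h1, h2, h3, h4⟩ := hall x hx
          exact Set.mem_biUnion (by simpa using ⟨by simpa using h1, h2, h3⟩) h4
        obtain ⟨p, hp, hle⟩ := (Ideal.subset_union_prime (f := id) ⊥ ⊥ (fun p hp _ _ =>
          (hfin.mem_toFinset.1 hp).2.1)).1 hsub
        obtain ⟨-, hp1, hp2⟩ := hfin.mem_toFinset.1 hp
        exact hp2 (le_antisymm (le_maximalIdeal hp1.ne_top) hle)
      have hxq : x ∉ q.asIdeal := hxF _ (Set.mem_insert _ _) q.2 hqm
      obtain ⟨q', hqq', hxq', hq'⟩ := exists_le_coheight_eq (e := e) hq hx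
      have hlt : q < q' := lt_of_le_of_ne hqq' (by rintro rfl; exact hxq hxq')
      have hq'' : Order.coheight q' = (e + 1 : ℕ) := by
        refine le_antisymm ?_ hq'
        have := Order.coheight_add_one_le hlt
        rw [hq] at this
        exact (ENat.add_le_add_iff_right (by simp : (1 : ℕ∞) ≠ ⊤)).1 (by exact_mod_cast this)
      obtain ⟨f, hf⟩ := exists_quotBy_surjective hqq' hxq'
      obtain ⟨δ, h1, -⟩ := exists_delta (J := maximalIdeal R) (lsmul_quotient_injective hxq)
        (LinearMap.exact_map_mkQ_range _) (Submodule.mkQ_surjective _) (e + 1)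
      have hs1 : Function.Surjective (lmap (maximalIdeal R) (e + 1)
          (LinearMap.range (LinearMap.lsmul R (R ⧸ q.asIdeal) x)).mkQ) :=
        fun c => (h1 c).1 (Subsingleton.elim _ _)
      have hs2 : Function.Surjective (lmap (maximalIdeal R) (e + 1) f) := by
        refine lmap_HM_surjective hf fun p hp => ?_
        have := coheight_lt_of_mem_support_quotBy (n := e + 2) (q := q) (p := p) (by
          rw [hq]; exact_mod_cast Nat.lt_succ_self _) hxq
          (Module.support_subset_of_injective _ (Submodule.injective_subtype _) hp)
        exact_mod_cast this
      have hnt := ih q' hq''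
      have hq3 : Order.coheight q' < (e + 1 : ℕ) + 1 := by
        rw [hq'']; exact_mod_cast Nat.lt_succ_self _
      have hmem := hF' _ (zeroOrSurjective_HM hq3) (_ ∘ₗ _) (hs2.comp hs1)
      rw [annihilator_HM hq3] at hmem
      exact hxF _ (Set.mem_insert_of_mem _ hmem) q'.2
        (ne_maximalIdeal_of_coheight_pos (by rw [hq'']; exact_mod_cast e.succ_ne_zero)) hxq'

end nonvanishing

section homPrime
variable {R : Type} [CommRing R] [IsNoetherianRing R]

lemma exists_ne_zero_of_minimal_support {N : Type*} [AddCommGroup N] [Module R N]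
    [Module.Finite R N] (p : PrimeSpectrum R) (hp : p ∈ Module.support R N)
    (hmin : ∀ L : Submodule R N, L ≠ ⊥ → p ∉ Module.support R (N ⧸ L)) :
    ∃ f : N →ₗ[R] R ⧸ p.asIdeal, f ≠ 0 := by
  have hsub : ∀ L : Submodule R N, L ≠ ⊥ → p ∈ Module.support R L := by
    intro L hL
    rw [Module.support_of_exact (LinearMap.exact_subtype_mkQ L) L.injective_subtype
      L.mkQ_surjective] at hp
    exact hp.resolve_right (hmin L hL)
  have hzero : ∀ x ∈ p.asIdeal, ∀ y : N, x • y = 0 := by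
    have h1 : p.asIdeal • (⊤ : Submodule R N) = ⊥ := by
      by_contra h
      refine hmin _ h ?_
      rw [Module.support_quotient]
      exact ⟨hp, fun _ h => h⟩
    intro x hx y
    have := Submodule.smul_mem_smul hx (Submodule.mem_top : y ∈ (⊤ : Submodule R N))
    rwa [h1] at this
  have htf : ∀ s ∉ p.asIdeal, ∀ y : N, s • y = 0 → y = 0 := by
    intro s hs y hy
    by_contra hy0
    have := hsub (R ∙ y) (by simpa using hy0)
    refine hs (Module.annihilator_le_of_mem_support this (Module.mem_annihilator.2 ?_))
    rintro ⟨z, hz⟩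
    obtain ⟨a, rfl⟩ := Submodule.mem_span_singleton.1 hz
    exact Subtype.ext (by simp [smul_comm s a y, hy])
  have : Nontrivial N := by
    rw [← Module.nonempty_support_iff (R := R)]
    exact ⟨p, hp⟩
  obtain ⟨y, hy⟩ := exists_ne (0 : N)
  have hker : LinearMap.ker (LinearMap.toSpanSingleton R N y) = p.asIdeal := by
    ext r
    rw [LinearMap.mem_ker, LinearMap.toSpanSingleton_apply]
    refine ⟨fun h => ?_, fun h => hzero r h y⟩
    by_contra hr
    exact hy (htf r hr y h)
  have hL : LinearMap.range (LinearMap.toSpanSingleton R N y) ≠ ⊥ := by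
    intro h
    have : y ∈ LinearMap.range (LinearMap.toSpanSingleton R N y) := ⟨1, by simp⟩
    rw [h] at this
    exact hy this
  have ht := hmin _ hL
  rw [Module.mem_support_iff_of_finite, SetLike.not_le_iff_exists] at ht
  obtain ⟨t, ht, htp⟩ := ht
  have hmem : ∀ z : N, LinearMap.lsmul R N t z ∈
      LinearMap.range (LinearMap.toSpanSingleton R N y) := by
    intro z
    have := Module.mem_annihilator.1 ht (Submodule.mkQ _ z)
    rw [← map_smul] at this
    exact (Submodule.Quotient.mk_eq_zero _).1 this
  let e := ((Submodule.quotEquivOfEq _ _ hker).symm.trans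
    (LinearMap.toSpanSingleton R N y).quotKerEquivRange).symm
  refine ⟨e.toLinearMap ∘ₗ (LinearMap.lsmul R N t).codRestrict _ hmem, fun h => hy ?_⟩
  have h1 := LinearMap.congr_fun h y
  have h2 := (map_eq_zero_iff e e.injective).1 h1
  exact htf t htp y (congrArg Subtype.val h2)

/-- A finite module with `p` in its support has a nonzero map to `R ⧸ p`. -/
theorem exists_ne_zero_of_mem_support {M : Type*} [AddCommGroup M] [Module R M]
    [Module.Finite R M] (p : PrimeSpectrum R) (hp : p ∈ Module.support R M) :
    ∃ f : M →ₗ[R] R ⧸ p.asIdeal, f ≠ 0 := by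
  obtain ⟨K, hK, hmax⟩ := set_has_maximal_iff_noetherian.2 (inferInstanceAs (IsNoetherian R M))
    {K : Submodule R M | p ∈ Module.support R (M ⧸ K)}
    ⟨⊥, by rwa [Set.mem_ofPred_eq, (Submodule.quotEquivOfEqBot ⊥ rfl).support_eq]⟩
  obtain ⟨f, hf⟩ := exists_ne_zero_of_minimal_support p hK fun L hL hpL => by
    refine hmax (L.comap K.mkQ) ?_ ?_
    · refine Module.support_subset_of_surjective
        (Submodule.mapQ (L.comap K.mkQ) L K.mkQ le_rfl) ?_ hpL
      intro y
      obtain ⟨y, rfl⟩ := L.mkQ_surjective y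
      obtain ⟨y, rfl⟩ := K.mkQ_surjective y
      exact ⟨Submodule.mkQ _ y, rfl⟩
    · refine lt_of_le_of_ne (Submodule.le_comap_mkQ K L) fun h => hL ?_
      have := congrArg (Submodule.map K.mkQ) h
      rwa [Submodule.mkQ_map_self, Submodule.map_comap_eq_of_surjective K.mkQ_surjective,
        eq_comm] at this
  refine ⟨f ∘ₗ K.mkQ, fun h => hf (LinearMap.ext fun y => ?_)⟩
  obtain ⟨y, rfl⟩ := K.mkQ_surjective y
  exact LinearMap.congr_fun h y

end homPrime

section top
open LocalCoh
variable {R : Type} [CommRing R] [IsLocalRing R] [IsNoetherianRing R]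

theorem annihilator_HM_le {M : Type} [AddCommGroup M] [Module R M]
    [Module.Finite R M] {d : ℕ} (hd : ∀ q ∈ Module.support R M, Order.coheight q ≤ d)
    {q : PrimeSpectrum R} (hq : q ∈ Module.support R M) (hqd : Order.coheight q = d) :
    Module.annihilator R (HM (R := R) d M) ≤ q.asIdeal := by
  have hlt : ∀ a : ℕ∞, a ≤ d → a < d + 1 := fun a ha =>
    ha.trans_lt (by exact_mod_cast Nat.lt_succ_self d)
  obtain ⟨f, hf⟩ := exists_ne_zero_of_mem_support q hq
  have hs1 : Function.Surjective (lmap (maximalIdeal R) d f.rangeRestrict) :=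
    lmap_HM_surjective f.surjective_rangeRestrict fun p hp =>
      hlt _ (hd p (Module.support_subset_of_injective _ (Submodule.injective_subtype _) hp))
  obtain ⟨y, hy, hy0⟩ := (Submodule.ne_bot_iff _).1 (mt LinearMap.range_eq_bot.1 hf)
  obtain ⟨x, rfl⟩ := Ideal.Quotient.mk_surjective y
  have hxq : x ∉ q.asIdeal := fun h => hy0 (Ideal.Quotient.eq_zero_iff_mem.2 h)
  obtain ⟨g, hg⟩ : ∃ g : QuotBy q.asIdeal x →ₗ[R] (R ⧸ q.asIdeal) ⧸ LinearMap.range f,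
      Function.Surjective g := by
    refine ⟨Submodule.factor ?_, Submodule.factor_surjective _⟩
    rintro _ ⟨z, rfl⟩
    obtain ⟨z, rfl⟩ := Ideal.Quotient.mk_surjective z
    have : LinearMap.lsmul R (R ⧸ q.asIdeal) x (Ideal.Quotient.mk _ z) =
        z • Ideal.Quotient.mk q.asIdeal x := by
      rw [LinearMap.lsmul_apply, ← Ideal.Quotient.mk_eq_mk, ← Ideal.Quotient.mk_eq_mk,
        ← Submodule.Quotient.mk_smul, ← Submodule.Quotient.mk_smul, smul_eq_mul, smul_eq_mul,
        mul_comm]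
    rw [this]
    exact Submodule.smul_mem _ _ hy
  have hs2 : Function.Surjective (lmap (maximalIdeal R) d (LinearMap.range f).subtype) := by
    have := subsingleton_HM d ((R ⧸ q.asIdeal) ⧸ LinearMap.range f) fun p hp =>
      coheight_lt_of_mem_support_quotBy (hlt _ hqd.le) hxq
        (Module.support_subset_of_surjective g hg hp)
    exact fun c => (exact_lmap (J := maximalIdeal R) (Submodule.injective_subtype _)
      (LinearMap.exact_subtype_mkQ _) (Submodule.mkQ_surjective _) d c).1 (Subsingleton.elim _ _)
  have := nontrivial_HM d q hqd
  rw [← annihilator_HM (hlt _ hqd.le)]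
  exact LinearMap.annihilator_le_of_surjective (_ ∘ₗ _) (hs2.comp hs1)

end top

section coattached
variable {R : Type} [CommRing R]

/-- `B` is a nonzero submodule killed by `p` and divisible by the elements outside `p`. -/
structure IsDivisibleAt {A : Type*} [AddCommGroup A] [Module R A] (p : Ideal R)
    (B : Submodule R A) : Prop where
  ne_bot : B ≠ ⊥
  smul_eq_bot : p • B = ⊥
  map_eq : ∀ s ∉ p, B.map (LinearMap.lsmul R A s) = B

section
variable {A C : Type*} [AddCommGroup A] [Module R A] [AddCommGroup C] [Module R C]
  {p : Ideal R} {B : Submodule R A}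

lemma IsDivisibleAt.smul_eq_zero (hB : IsDivisibleAt p B) {x : R} (hx : x ∈ p) {b : A}
    (hb : b ∈ B) : x • b = 0 := by
  have := Submodule.smul_mem_smul hx hb
  rwa [hB.smul_eq_bot] at this

lemma IsDivisibleAt.le_of_forall (hB : IsDivisibleAt p B) {q : Ideal R}
    (hq : ∀ x ∈ q, ∀ b : A, x • b = 0) : q ≤ p := by
  intro x hx
  by_contra hxp
  refine hB.ne_bot ?_
  rw [eq_bot_iff, ← hB.map_eq x hxp]
  rintro _ ⟨b, -, rfl⟩
  exact hq x hx b

lemma map_lsmul_comm (g : A →ₗ[R] C) (s : R) (B : Submodule R A) :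
    (B.map (LinearMap.lsmul R A s)).map g = (B.map g).map (LinearMap.lsmul R C s) := by
  rw [← Submodule.map_comp, ← Submodule.map_comp]
  congr 1
  ext y
  exact map_smul g s y

lemma IsDivisibleAt.map (hB : IsDivisibleAt p B) {g : A →ₗ[R] C} (hg : B.map g ≠ ⊥) :
    IsDivisibleAt p (B.map g) :=
  ⟨hg, by rw [← Submodule.map_smul'', hB.smul_eq_bot, Submodule.map_bot], fun s hs => by
    rw [← map_lsmul_comm, hB.map_eq s hs]⟩

/-- Divisible submodules can be lifted along maps out of Artinian modules. -/
theorem IsDivisibleAt.exists_lift [IsNoetherianRing R] [IsArtinian R C]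
    (hB : IsDivisibleAt p B) (g : C →ₗ[R] A) (hg : B ≤ LinearMap.range g) :
    ∃ B' : Submodule R C, IsDivisibleAt p B' := by
  obtain ⟨B', hB', hmin⟩ := IsArtinian.set_has_minimal {B' : Submodule R C | B'.map g = B}
    ⟨B.comap g, by
      rw [Set.mem_ofPred_eq, Submodule.map_comap_eq, inf_eq_right.2 hg]⟩
  replace hB' : B'.map g = B := hB'
  have hmin' : ∀ L ≤ B', L.map g = B → L = B' := fun L hL h =>
    by_contra fun hne => hmin L h (lt_of_le_of_ne hL hne)
  have hdiv : ∀ s ∉ p, B'.map (LinearMap.lsmul R C s) = B' := fun s hs => by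
    refine hmin' _ ?_ (by rw [map_lsmul_comm, hB', hB.map_eq s hs])
    rintro _ ⟨b, hb, rfl⟩
    exact B'.smul_mem s hb
  have hnil : ∀ x ∈ p, ∃ k : ℕ, ∀ b ∈ B', x ^ k • b = 0 := by
    intro x hx
    obtain ⟨k, hk, hk1⟩ := ((LinearMap.eventually_codisjoint_ker_pow_range_pow
      (LinearMap.lsmul R B' x)).and (Filter.eventually_ge_atTop 1)).exists
    have hpow : ∀ y, (LinearMap.lsmul R B' x ^ k) y = x ^ k • y := fun y => by
      rw [Module.End.pow_apply]
      exact congrFun (smul_iterate x k) y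
    have hker := hmin' ((LinearMap.ker (LinearMap.lsmul R B' x ^ k)).map B'.subtype)
      (Submodule.map_subtype_le _ _) (by
        refine le_antisymm ((Submodule.map_mono (Submodule.map_subtype_le _ _)).trans hB'.le) ?_
        rw [← hB']
        rintro _ ⟨b, hb, rfl⟩
        obtain ⟨u, hu, _, ⟨w, rfl⟩, huv⟩ := Submodule.mem_sup.1
          (hk.eq_top ▸ Submodule.mem_top : (⟨b, hb⟩ : B') ∈ _ ⊔ _)
        refine ⟨u, ⟨u, hu, rfl⟩, ?_⟩
        have h1 : b = u + x ^ k • (w : C) := by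
          rw [hpow] at huv
          exact (congrArg Subtype.val huv).symm
        have h2 : x ^ k • g w = 0 := by
          obtain ⟨k, rfl⟩ := Nat.exists_eq_add_of_le' hk1
          rw [pow_succ, mul_smul, hB.smul_eq_zero hx (hB' ▸ ⟨w, w.2, rfl⟩), smul_zero]
        rw [h1, map_add, map_smul, h2, add_zero])
    refine ⟨k, fun b hb => ?_⟩
    rw [← hker] at hb
    obtain ⟨u, hu, rfl⟩ := hb
    have := LinearMap.mem_ker.1 hu
    rw [hpow] at this
    exact congrArg Subtype.val this
  have hrad : p ≤ (Module.annihilator R B').radical := by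
    intro x hx
    obtain ⟨k, hk⟩ := hnil x hx
    exact ⟨k, Module.mem_annihilator.2 fun b => Subtype.ext (hk b b.2)⟩
  have hpow : ∃ k, p ^ k • B' = ⊥ := by
    obtain ⟨k, hk⟩ := Ideal.exists_pow_le_of_le_radical_of_fg hrad p.fg_of_isNoetherianRing
    refine ⟨k, eq_bot_iff.2 (Submodule.smul_le.2 fun r hr b hb => ?_)⟩
    exact congrArg Subtype.val (Module.mem_annihilator.1 (hk hr) ⟨b, hb⟩)
  classical
  have hne : B' ≠ ⊥ := by
    rintro rfl
    exact hB.ne_bot (by rw [← hB', Submodule.map_bot])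
  have hspec := Nat.find_spec hpow
  obtain ⟨k, hk⟩ : ∃ k, Nat.find hpow = k + 1 := by
    refine Nat.exists_eq_add_one_of_ne_zero fun h => hne ?_
    rwa [h, pow_zero, Ideal.one_eq_top, Submodule.top_smul] at hspec
  refine ⟨p ^ k • B', Nat.find_min hpow (by omega), ?_, fun s hs => ?_⟩
  · rw [← Submodule.mul_smul, ← pow_succ', ← hk]
    exact hspec
  · rw [Submodule.map_smul'', hdiv s hs]

end

/-- Primes in the support are detected on the dual with respect to an injective module
containing the residue field. -/
theorem exists_isDivisibleAt_hom [IsNoetherianRing R] [IsLocalRing R] {W : Type*} {E : Type}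
    [AddCommGroup W] [Module R W] [Module.Finite R W] [AddCommGroup E] [Module R E]
    (hE : Module.Injective R E) {i : (R ⧸ maximalIdeal R) →ₗ[R] E} (hi : Function.Injective i)
    {p : PrimeSpectrum R} (hp : p ∈ Module.support R W) :
    ∃ B : Submodule R (W →ₗ[R] E), IsDivisibleAt p.asIdeal B := by
  obtain ⟨f, hf⟩ := exists_ne_zero_of_mem_support p hp
  set I := LinearMap.range f
  have hI : Nontrivial I := Submodule.nontrivial_iff_ne_bot.2 (mt LinearMap.range_eq_bot.1 hf)
  refine ⟨LinearMap.range (LinearMap.lcomp R E f.rangeRestrict), ?_, ?_, fun s hs => ?_⟩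
  · have hcl : closedPoint R ∈ Module.support R I := by
      rw [Module.mem_support_iff_of_finite]
      exact le_maximalIdeal fun h => not_subsingleton I (Module.annihilator_eq_top_iff.1 h)
    obtain ⟨g, hg⟩ := exists_ne_zero_of_mem_support _ hcl
    intro h
    refine hg (LinearMap.ext fun z => hi ?_)
    obtain ⟨w, rfl⟩ := f.surjective_rangeRestrict z
    have h1 : LinearMap.lcomp R E f.rangeRestrict (i ∘ₗ g) ∈
        LinearMap.range (LinearMap.lcomp R E f.rangeRestrict) := ⟨_, rfl⟩
    rw [h] at h1
    exact (LinearMap.congr_fun ((Submodule.mem_bot R).1 h1) w).trans (map_zero i).symm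
  · rw [eq_bot_iff]
    refine Submodule.smul_le.2 ?_
    rintro x hx _ ⟨g, rfl⟩
    refine (Submodule.mem_bot R).2 (LinearMap.ext fun w => ?_)
    change x • g (f.rangeRestrict w) = 0
    rw [← map_smul, ← map_smul]
    have : f.rangeRestrict (x • w) = 0 :=
      Subtype.ext ((map_smul f x w).trans (smul_quotient_eq_zero hx _))
    rw [this, map_zero]
  · refine le_antisymm ?_ ?_
    · rintro _ ⟨_, hg, rfl⟩
      exact Submodule.smul_mem _ s hg
    · rintro _ ⟨g, rfl⟩
      have hinj : Function.Injective (LinearMap.lsmul R I s) := by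
        rw [injective_iff_map_eq_zero]
        intro z hz
        exact Subtype.ext ((injective_iff_map_eq_zero _).1 (lsmul_quotient_injective hs) z
          (congrArg Subtype.val hz))
      obtain ⟨h, hh⟩ := hE.out _ hinj g
      refine ⟨LinearMap.lcomp R E f.rangeRestrict h, ⟨h, rfl⟩, LinearMap.ext fun w => ?_⟩
      change s • h (f.rangeRestrict w) = g (f.rangeRestrict w)
      rw [← hh, ← map_smul]
      rfl

end coattached

section chains
open LocalCoh
variable {R : Type} [CommRing R] [IsLocalRing R] [IsNoetherianRing R]

lemma IsDivisibleAt.exists_of_exact {A₁ A₂ A₃ : Type} [AddCommGroup A₁] [Module R A₁]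
    [AddCommGroup A₂] [Module R A₂] [AddCommGroup A₃] [Module R A₃] [IsArtinian R A₁]
    {f : A₁ →ₗ[R] A₂} {g : A₂ →ₗ[R] A₃} (hfg : Function.Exact f g) {p : Ideal R}
    {B : Submodule R A₂} (hB : IsDivisibleAt p B) :
    (∃ B₁ : Submodule R A₁, IsDivisibleAt p B₁) ∨ ∃ B₃ : Submodule R A₃, IsDivisibleAt p B₃ := by
  by_cases h : B.map g = ⊥
  · refine Or.inl (hB.exists_lift f fun b hb => (hfg b).1 ?_)
    exact (Submodule.mem_bot R).1 (h ▸ ⟨b, hb, rfl⟩)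
  · exact Or.inr ⟨_, hB.map h⟩

theorem exists_ltSeries_of_isDivisibleAt (p : PrimeSpectrum R) (n : ℕ) :
    ∀ (M : Type) [AddCommGroup M] [Module R M] [Module.Finite R M],
    (∃ B : Submodule R (HM (R := R) n M), IsDivisibleAt p.asIdeal B) →
    ∃ c : LTSeries (PrimeSpectrum R), c.head ∈ Module.support R M ∧ c.last = p ∧
      n ≤ c.length + Order.coheight p := by
  induction n with
  | zero =>
    intro M _ _ hM
    induction hM using IsNoetherianRing.induction_on_isQuotientEquivQuotientPrime R with
    | subsingleton N =>
      rintro ⟨B, hB⟩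
      have := subsingleton_LH (J := maximalIdeal R) (M := N) 0
      exact absurd (Subsingleton.elim B ⊥) hB.ne_bot
    | quotient N q e =>
      rintro ⟨B, hB⟩
      refine ⟨RelSeries.singleton _ p, ?_, rfl, by simp⟩
      rw [e.support_eq, mem_support_quotient]
      refine hB.le_of_forall fun x hx => smul_HM_eq_zero fun y => ?_
      apply e.injective
      rw [map_smul, smul_quotient_eq_zero hx, map_zero]
    | exact N₁ N₂ N₃ f g hf hg hfg h₁ h₃ =>
      rintro ⟨B, hB⟩
      rw [Module.support_of_exact hfg hf hg]
      have := isArtinian_HM (R := R) 0 N₁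
      rcases hB.exists_of_exact (exact_lmap (J := maximalIdeal R) hf hfg hg 0) with h | h
      · obtain ⟨c, h1, h2⟩ := h₁ h
        exact ⟨c, Or.inl h1, h2⟩
      · obtain ⟨c, h1, h2⟩ := h₃ h
        exact ⟨c, Or.inr h1, h2⟩
  | succ n ih =>
    intro M _ _ hM
    induction hM using IsNoetherianRing.induction_on_isQuotientEquivQuotientPrime R with
    | subsingleton N =>
      rintro ⟨B, hB⟩
      have := subsingleton_LH (J := maximalIdeal R) (M := N) (n + 1)
      exact absurd (Subsingleton.elim B ⊥) hB.ne_bot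
    | quotient N q e =>
      rintro ⟨B, hB⟩
      rw [e.support_eq]
      obtain ⟨B, hB⟩ : ∃ B : Submodule R (HM (R := R) (n + 1) (R ⧸ q.asIdeal)),
          IsDivisibleAt p.asIdeal B := by
        refine ⟨_, hB.map (g := (lequiv (maximalIdeal R) (n + 1) e).toLinearMap) ?_⟩
        rw [Ne, Submodule.map_eq_bot_iff]
        exact hB.ne_bot
      have hqp : q ≤ p :=
        hB.le_of_forall fun x hx => smul_HM_eq_zero (smul_quotient_eq_zero hx)
      rcases hqp.eq_or_lt with rfl | hlt
      · refine ⟨RelSeries.singleton _ q, mem_support_quotient.2 le_rfl, rfl, ?_⟩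
        by_contra hcon
        have := subsingleton_HM (n + 1) (R ⧸ q.asIdeal) fun p hp =>
          (Order.coheight_anti (show q ≤ p from mem_support_quotient.1 hp)).trans_lt (by simpa using hcon)
        exact hB.ne_bot (Subsingleton.elim B ⊥)
      · obtain ⟨x, hxp, hxq⟩ := SetLike.exists_of_lt (show q.asIdeal < p.asIdeal from hlt)
        obtain ⟨δ, -, h2⟩ := exists_delta (J := maximalIdeal R) (lsmul_quotient_injective hxq)
          (LinearMap.exact_map_mkQ_range _) (Submodule.mkQ_surjective _) n
        have := isArtinian_HM (R := R) n (QuotBy q.asIdeal x)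
        obtain ⟨c, h1, h2, h3⟩ := ih (QuotBy q.asIdeal x) (hB.exists_lift δ fun b hb =>
          (h2 b).1 (by rw [lmap_lsmul, hB.smul_eq_zero hxp hb]))
        have hlt' : q < c.head := lt_of_le_of_ne (le_of_mem_support_quotBy h1) fun h =>
          hxq (h ▸ mem_of_mem_support_quotBy h1)
        refine ⟨c.cons q hlt', mem_support_quotient.2 (by simp), by simp [h2], ?_⟩
        rw [RelSeries.cons_length, Nat.cast_add, Nat.cast_add, add_right_comm]
        gcongr
    | exact N₁ N₂ N₃ f g hf hg hfg h₁ h₃ =>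
      rintro ⟨B, hB⟩
      rw [Module.support_of_exact hfg hf hg]
      have := isArtinian_HM (R := R) (n + 1) N₁
      rcases hB.exists_of_exact (exact_lmap (J := maximalIdeal R) hf hfg hg (n + 1)) with h | h
      · obtain ⟨c, h1, h2⟩ := h₁ h
        exact ⟨c, Or.inl h1, h2⟩
      · obtain ⟨c, h1, h2⟩ := h₃ h
        exact ⟨c, Or.inr h1, h2⟩

end chains

section dimension
variable {R : Type} [CommRing R] {M : Type} [AddCommGroup M] [Module R M]

lemma mem_support_localizedModule_iff {p : Ideal R} [p.IsPrime]
    {x : PrimeSpectrum (Localization.AtPrime p)} :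
    x ∈ Module.support (Localization.AtPrime p) (LocalizedModule p.primeCompl M) ↔
      x.comap (algebraMap R _) ∈ Module.support R M := by
  simp only [Module.mem_support_iff', PrimeSpectrum.comap_asIdeal, Ideal.mem_comap]
  constructor
  · rintro ⟨m, hm⟩
    induction m using LocalizedModule.induction_on with
    | h m s =>
      refine ⟨m, fun r hr h => hm _ hr ?_⟩
      rw [algebraMap_smul, LocalizedModule.smul'_mk, h, LocalizedModule.zero_mk]
  · rintro ⟨m, hm⟩
    refine ⟨LocalizedModule.mk m 1, fun a ha h => ?_⟩
    obtain ⟨r, s, rfl⟩ := IsLocalization.exists_mk'_eq p.primeCompl a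
    have hr : algebraMap R (Localization.AtPrime p) r ∉ x.asIdeal := fun hr => ha (by
      rw [IsLocalization.mk'_eq_mul_mk'_one]
      exact Ideal.mul_mem_right _ _ hr)
    have h1 : algebraMap R (Localization.AtPrime p) r • LocalizedModule.mk (S := p.primeCompl) m 1
        = 0 := by
      rw [← IsLocalization.mk'_spec' _ r s, mul_smul, h, smul_zero]
    rw [algebraMap_smul, LocalizedModule.smul'_mk, ← LocalizedModule.zero_mk 1,
      LocalizedModule.mk_eq] at h1
    obtain ⟨t, ht⟩ := h1
    simp only [one_smul, smul_zero] at ht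
    refine hm (t * r) (fun htr => ?_) (by rw [mul_smul]; exact ht)
    rw [map_mul] at htr
    exact (x.2.mem_or_mem htr).elim (fun h => x.2.ne_top
      (Ideal.eq_top_of_isUnit_mem _ h (IsLocalization.map_units _ t))) hr

/-- The support of a localization at `p` is the part of the support below `p`. -/
def supportLocalizedModuleOrderIso (P : Module.support R M) :
    Module.support (Localization.AtPrime P.1.asIdeal)
      (LocalizedModule P.1.asIdeal.primeCompl M) ≃o Set.Iic P :=
  let e := IsLocalization.AtPrime.primeSpectrumOrderIso
    (Localization.AtPrime P.1.asIdeal) P.1.asIdeal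
  { toFun := fun x => ⟨⟨(e x.1).1, mem_support_localizedModule_iff.1 x.2⟩, (e x.1).2⟩
    invFun := fun y => ⟨e.symm ⟨y.1.1, y.2⟩, mem_support_localizedModule_iff.2 (by
      have h : (e (e.symm ⟨y.1.1, y.2⟩)).1 = y.1.1 := by rw [e.apply_symm_apply]
      exact (congrArg (· ∈ Module.support R M) h).mpr y.1.2)⟩
    left_inv := fun x => Subtype.ext (e.symm_apply_apply x.1)
    right_inv := by
      rintro ⟨⟨y, h1⟩, h2⟩
      have h : (e (e.symm ⟨y, h2⟩)).1 = y := by rw [e.apply_symm_apply]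
      exact Subtype.ext (Subtype.ext h)
    map_rel_iff' := fun {a b} => e.le_iff_le (x := a.1) (y := b.1) }

lemma htM_eq_height (P : Module.support R M) : htM R M P.1 = Order.height P := by
  rw [htM, mdim, Order.krullDim_eq_of_orderIso (supportLocalizedModuleOrderIso P),
    Order.height_eq_krullDim_Iic]

lemma rdim_quotient_eq_coheight (p : PrimeSpectrum R) :
    rdim (R ⧸ p.asIdeal) = Order.coheight p := by
  rw [rdim, Order.coheight_eq_krullDim_Ici,
    Order.krullDim_eq_of_orderIso p.asIdeal.primeSpectrumQuotientOrderIsoZeroLocus]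
  rfl

lemma coheight_coe_support (P : Module.support R M) :
    Order.coheight P.1 = Order.coheight P := by
  rw [← WithBot.coe_inj, Order.coheight_eq_krullDim_Ici, Order.coheight_eq_krullDim_Ici]
  refine Order.krullDim_eq_of_orderIso
    { toFun := fun x => ⟨⟨x.1, Module.mem_support_mono x.2 P.2⟩, x.2⟩
      invFun := fun y => ⟨y.1.1, y.2⟩
      left_inv := fun _ => rfl
      right_inv := fun _ => rfl
      map_rel_iff' := Iff.rfl }

lemma height_add_coheight_le {d : ℕ} (hd : mdim R M = d) (P : Module.support R M) :
    Order.height P + Order.coheight P ≤ d := by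
  have : Nonempty (Module.support R M) := ⟨P⟩
  rw [mdim, Order.krullDim_eq_iSup_height_add_coheight_of_nonempty] at hd
  rw [← WithBot.coe_inj.1 hd]
  exact le_iSup (fun P : Module.support R M => Order.height P + Order.coheight P) P

/-- Chains starting in the support stay there. -/
def liftLTSeries (c : LTSeries (PrimeSpectrum R)) (hc : c.head ∈ Module.support R M) :
    LTSeries (Module.support R M) where
  length := c.length
  toFun i := ⟨c i, Module.mem_support_mono (LTSeries.head_le c i) hc⟩
  step i := c.step i

theorem htM_add_rdim_eq_iff {d : ℕ} {p : PrimeSpectrum R}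
    (P : Module.support R M) (hP : P.1 = p) :
    htM R M p + rdim (R ⧸ p.asIdeal) = d ↔ Order.height P + Order.coheight P = d := by
  subst hP
  rw [htM_eq_height, rdim_quotient_eq_coheight, coheight_coe_support, ← WithBot.coe_add]
  exact WithBot.coe_inj

lemma exists_le_coheight_eq_of_height_add_coheight {d : ℕ} (hd : mdim R M = d)
    (P : Module.support R M) (h : Order.height P + Order.coheight P = d) :
    ∃ Q : Module.support R M, Q ≤ P ∧ Order.coheight Q.1 = d := by
  obtain ⟨a, ha⟩ := ENat.ne_top_iff_exists.1 (show Order.height P ≠ ⊤ from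
    fun ht => by simp [ht] at h)
  obtain ⟨b, hb⟩ := ENat.ne_top_iff_exists.1 (show Order.coheight P ≠ ⊤ from
    fun ht => by simp [ht] at h)
  obtain ⟨c, hc, hca⟩ := Order.exists_series_of_height_eq_coe P ha.symm
  obtain ⟨c', hc', hcb⟩ := Order.exists_series_of_coheight_eq_coe P hb.symm
  refine ⟨c.head, hc ▸ c.head_le_last, ?_⟩
  rw [coheight_coe_support]
  refine le_antisymm (le_add_self.trans (height_add_coheight_le hd c.head)) ?_
  rw [← h, ← ha, ← hb, ← hca, ← hcb]
  have := Order.length_le_coheight (x := c.head) (p := RelSeries.smash c c' (hc.trans hc'.symm))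
    (by simp)
  rw [RelSeries.smash_length] at this
  exact_mod_cast this

end dimension

end

theorem stmt2 (R : Type) [CommRing R] [IsNoetherianRing R] [IsLocalRing R]
    (d' : ℕ) (M ω : ModuleCat R) (hM : Module.Finite R ↥M)
    (hdim : mdim R ↥M = (d' : WithBot ℕ∞))
    (hω : IsCanonicalModule R (maximalIdeal R) d' M ω) :
    Module.support R ↥ω =
      {p ∈ Module.support R ↥M |
        htM R ↥M p + rdim (R ⧸ p.asIdeal) = (d' : WithBot ℕ∞)} := by
  obtain ⟨hfin, E, ⟨hE, i, hi, -⟩, ⟨e⟩⟩ := hω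
  replace e : (ω →ₗ[R] E) ≃ₗ[R] HM (R := R) d' M := e
  ext p
  constructor
  · intro hp
    obtain ⟨B, hB⟩ := exists_isDivisibleAt_hom (W := ω) hE hi hp
    obtain ⟨c, hc, rfl, hcd⟩ := exists_ltSeries_of_isDivisibleAt p d' M
      ⟨_, hB.map (g := e.toLinearMap) (by
        rw [Ne, Submodule.map_eq_bot_iff]
        exact hB.ne_bot)⟩
    have hmem : c.last ∈ Module.support R M := Module.mem_support_mono c.head_le_last hc
    refine ⟨hmem, (htM_add_rdim_eq_iff ⟨_, hmem⟩ rfl).2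
      (le_antisymm (height_add_coheight_le hdim _) (hcd.trans ?_))⟩
    rw [← coheight_coe_support]
    gcongr
    exact Order.length_le_height (p := liftLTSeries c hc) le_rfl
  · rintro ⟨hp, h⟩
    obtain ⟨Q, hQ, hQd⟩ := exists_le_coheight_eq_of_height_add_coheight hdim _
      ((htM_add_rdim_eq_iff ⟨p, hp⟩ rfl).1 h)
    rw [Module.mem_support_iff_of_finite]
    refine le_trans (fun r hr => ?_) (show Q.1.asIdeal ≤ p.asIdeal from hQ)
    refine annihilator_HM_le (fun q hq => ?_) Q.2 hQd ?_
    · rw [show Order.coheight q = _ from coheight_coe_support (M := M) ⟨q, hq⟩]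
      exact le_add_self.trans (height_add_coheight_le hdim _)
    · rw [Module.mem_annihilator] at hr ⊢
      intro y
      obtain ⟨g, rfl⟩ := e.surjective y
      rw [← map_smul, show r • g = 0 from LinearMap.ext fun w => by
        rw [LinearMap.smul_apply, ← map_smul, hr, map_zero, LinearMap.zero_apply], map_zero]
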